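/- Let k ≥ 5 and t ≥ 1 be integers. There exists n₀ such that for all n ≥ n₀, any k-uniform hypergraph on vertex set [n] with exactly C(n,k) − C(n−t,k) + C(n−t−2,k−2) edges and containing no k-uniform linear cycle of length 2t+2 consists exactly of all k-subsets of [n] that meet some fixed t-element set S, together with all k-subsets of [n]∖S that contain some two fixed elements of [n]∖S. -/

import Mathlib

/-- A `k`-uniform linear cycle of length `ℓ`: a cyclic list of `k`-sets such that
consecutive sets (cyclically) intersect in exactly one element and
nonconsecutive sets are disjoint. -/
def IsLinearCycle (k ℓ : ℕ) {n : ℕ} (A : ZMod ℓ → Finset (Fin n)) : Prop :=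
  Function.Injective A ∧ (∀ i, (A i).card = k) ∧
  (∀ i, (A i ∩ A (i + 1)).card = 1) ∧
  (∀ i j : ZMod ℓ, j ≠ i → j ≠ i + 1 → i ≠ j + 1 → Disjoint (A i) (A j))

namespace LinearCycle

open Finset

section Homogeneous

variable {ι V : Type} [Fintype ι] [DecidableEq ι] [DecidableEq V]

/-- The coordinates on which two functions agree. -/
def agree (f g : ι → V) : Finset ι := univ.filter fun i => f i = g i

omit [DecidableEq ι] in
lemma mem_agree {f g : ι → V} {i : ι} : i ∈ agree f g ↔ f i = g i := by simp [agree]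

/-- The restriction of `f` to `I` is a kernel of `F` of strength `q`: any `q` values can be avoided
outside `I` by a member of `F` extending this restriction. -/
def FunKernel (q : ℕ) (F : Finset (ι → V)) (I : Finset ι) (f : ι → V) : Prop :=
  ∀ Q : Finset V, Q.card ≤ q → ∃ g ∈ F, (∀ i ∈ I, g i = f i) ∧ ∀ i ∉ I, g i ∉ Q

open scoped Classical in
/-- If the restriction of `f` to `I` is not a kernel, a positive proportion of its extensions
share a further value. -/
lemma exists_popular_value {q : ℕ} {F : Finset (ι → V)} {I : Finset ι} {f : ι → V}
    (h : ¬ FunKernel q F I f) :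
    ∃ T ⊆ F.filter (fun g => ∀ i ∈ I, g i = f i), (∀ g ∈ T, ∀ g' ∈ T, agree g g' ≠ I) ∧
      (F.filter (fun g => ∀ i ∈ I, g i = f i)).card ≤ Fintype.card ι * q * T.card := by
  unfold FunKernel at h
  push Not at h
  obtain ⟨Q, hQ, h⟩ := h
  set St := F.filter (fun g => ∀ i ∈ I, g i = f i) with hSt
  let part : ι × V → Finset (ι → V) := fun p => St.filter fun g => g p.1 = p.2
  let idx : Finset (ι × V) := (univ.filter fun i => i ∉ I) ×ˢ Q
  have hcov : St ⊆ idx.biUnion part := by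
    intro g hg
    have hg' := hg
    rw [hSt, mem_filter] at hg'
    obtain ⟨i, hi, hiQ⟩ := h g hg'.1 hg'.2
    simp only [mem_biUnion, idx, part, mem_product, mem_filter, mem_univ, true_and]
    exact ⟨(i, g i), ⟨hi, hiQ⟩, hg, rfl⟩
  rcases idx.eq_empty_or_nonempty with he | hne
  · refine ⟨∅, by simp, by simp, ?_⟩
    rw [he] at hcov
    simpa using hcov
  obtain ⟨p, hp, hmax⟩ := exists_max_image idx (fun p => (part p).card) hne
  refine ⟨part p, filter_subset _ _, ?_, ?_⟩
  · intro g hg g' hg' hagree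
    simp only [part, mem_filter] at hg hg'
    simp only [idx, mem_product, mem_filter, mem_univ, true_and] at hp
    apply hp.1
    rw [← hagree, mem_agree, hg.2, hg'.2]
  · calc St.card ≤ (idx.biUnion part).card := card_le_card hcov
      _ ≤ ∑ p ∈ idx, (part p).card := card_biUnion_le
      _ ≤ idx.card * (part p).card := by
        rw [← smul_eq_mul]; exact sum_le_card_nsmul _ _ _ hmax
      _ ≤ Fintype.card ι * q * (part p).card := by
        gcongr
        rw [card_product]
        gcongr
        exact card_le_univ _

open scoped Classical in
lemma exists_full_subfamily (q : ℕ) (𝒦 : Finset (Finset ι)) (F : Finset (ι → V)) :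
    ∃ F₀ ⊆ F, ∃ R : Finset ι → Finset (ι → V),
      (∀ f ∈ F₀, ∀ I ∈ 𝒦, FunKernel q F₀ I f) ∧ (∀ I, R I ⊆ F) ∧
      (∀ I, ∀ f ∈ R I, ∀ g ∈ R I, agree f g ≠ I) ∧
      F.card ≤ F₀.card + Fintype.card ι * q * ∑ I ∈ 𝒦, (R I).card := by
  induction F using Finset.strongInduction with
  | H F ih =>
  by_cases hfull : ∀ f ∈ F, ∀ I ∈ 𝒦, FunKernel q F I f
  · exact ⟨F, Subset.rfl, fun _ => ∅, hfull, by simp, by simp, by simp⟩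
  push Not at hfull
  obtain ⟨f, hf, I, hI, hker⟩ := hfull
  obtain ⟨T, hT, hTI, hTcard⟩ := exists_popular_value hker
  set St := F.filter (fun g => ∀ i ∈ I, g i = f i) with hSt
  have hStF : St ⊆ F := filter_subset _ _
  have hfSt : f ∈ St := by simp [hSt, hf]
  obtain ⟨F₀, hF₀, R, h1, h2, h3, h4⟩ := ih (F \ St) (sdiff_ssubset hStF ⟨f, hfSt⟩)
  refine ⟨F₀, hF₀.trans sdiff_subset, Function.update R I (R I ∪ T), h1, ?_, ?_, ?_⟩
  · intro I'
    by_cases hI' : I' = I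
    · subst hI'
      simp only [Function.update_self]
      exact union_subset ((h2 _).trans sdiff_subset) (hT.trans hStF)
    · rw [Function.update_of_ne hI']
      exact (h2 _).trans sdiff_subset
  · intro I'
    by_cases hI' : I' = I
    · subst hI'
      simp only [Function.update_self]
      have key : ∀ a ∈ R I', ∀ b ∈ T, ∃ i ∈ I', a i ≠ b i := by
        intro a ha b hb
        have ha' := mem_sdiff.1 (h2 _ ha)
        by_contra! hcon
        apply ha'.2
        rw [hSt, mem_filter]
        refine ⟨ha'.1, fun i hi => ?_⟩
        rw [hcon i hi]
        exact (mem_filter.1 (hT hb)).2 i hi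
      intro a ha b hb hab
      rcases mem_union.1 ha with ha | ha <;> rcases mem_union.1 hb with hb | hb
      · exact h3 _ a ha b hb hab
      · obtain ⟨i, hi, hne⟩ := key a ha b hb
        rw [← hab, mem_agree] at hi
        exact hne hi
      · obtain ⟨i, hi, hne⟩ := key b hb a ha
        rw [← hab, mem_agree] at hi
        exact hne hi.symm
      · exact hTI a ha b hb hab
    · rw [Function.update_of_ne hI']
      exact h3 _
  · have hsum : ∑ I' ∈ 𝒦, (Function.update R I (R I ∪ T) I').card
        = ∑ I' ∈ 𝒦, (R I').card + T.card := by
      rw [← add_sum_erase _ _ hI, ← add_sum_erase 𝒦 (fun I' => (R I').card) hI]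
      rw [Function.update_self, card_union_of_disjoint]
      · have : ∑ x ∈ 𝒦.erase I, (Function.update R I (R I ∪ T) x).card
            = ∑ x ∈ 𝒦.erase I, (R x).card :=
          sum_congr rfl fun x hx => by rw [Function.update_of_ne (ne_of_mem_erase hx)]
        rw [this]
        ring
      · exact disjoint_of_subset_left (h2 I) (disjoint_of_subset_right hT sdiff_disjoint)
    have hcard : F.card = (F \ St).card + St.card := (card_sdiff_add_card_eq_card hStF).symm
    rw [hsum, mul_add, hcard]
    omega

end Homogeneous

section Homogeneous

open scoped Classical in
lemma exists_homogeneous_of_types (ι : Type) [Fintype ι] [DecidableEq ι] (q m : ℕ) :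
    ∃ C : ℕ, ∀ (V : Type) [DecidableEq V] (𝒦 : Finset (Finset ι))
    (F : Finset (ι → V)), 𝒦.card ≤ m → (∀ f ∈ F, ∀ g ∈ F, f ≠ g → agree f g ∈ 𝒦) →
    ∃ F' ⊆ F, ∃ J ⊆ 𝒦, F.card ≤ C * F'.card ∧
      (∀ f ∈ F', ∀ g ∈ F', f ≠ g → agree f g ∈ J) ∧
      ∀ f ∈ F', ∀ I ∈ J, FunKernel q F' I f := by
  induction m with
  | zero =>
    refine ⟨1, fun V _ 𝒦 F h𝒦 hF => ⟨F, Subset.rfl, 𝒦, Subset.rfl, by simp, hF, ?_⟩⟩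
    rw [Nat.le_zero, card_eq_zero] at h𝒦
    simp [h𝒦]
  | succ m ih =>
    obtain ⟨C, hC⟩ := ih
    refine ⟨1 + Fintype.card ι * q * ((m + 1) * C), fun V _ 𝒦 F h𝒦 hF => ?_⟩
    obtain ⟨F₀, hF₀, R, hfull, hRF, hRI, hcard⟩ := exists_full_subfamily q 𝒦 F
    have hstep : ∀ I : Finset ι, ∃ F' ⊆ F, I ∈ 𝒦 → ∃ J ⊆ 𝒦, (R I).card ≤ C * F'.card ∧
      (∀ f ∈ F', ∀ g ∈ F', f ≠ g → agree f g ∈ J) ∧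
      ∀ f ∈ F', ∀ I ∈ J, FunKernel q F' I f := by
      intro I
      by_cases hI : I ∈ 𝒦
      · obtain ⟨F', hF', J, hJ, h1, h2, h3⟩ := hC V (𝒦.erase I) (R I)
          (by rw [card_erase_of_mem hI]; omega)
          (fun f hf g hg hfg => mem_erase.2
            ⟨hRI I f hf g hg, hF f (hRF I hf) g (hRF I hg) hfg⟩)
        exact ⟨F', hF'.trans (hRF I), fun _ => ⟨J, hJ.trans (erase_subset _ _), h1, h2, h3⟩⟩
      · exact ⟨∅, by simp, fun h => absurd h hI⟩
    choose S hSF hS using hstep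
    rcases 𝒦.eq_empty_or_nonempty with he | hne
    · exact ⟨F, Subset.rfl, 𝒦, Subset.rfl, Nat.le_mul_of_pos_left _ (by omega), hF, by simp [he]⟩
    obtain ⟨I, hI, hmax⟩ := exists_max_image 𝒦 (fun I => (S I).card) hne
    have hsum : ∑ I ∈ 𝒦, (R I).card ≤ (m + 1) * (C * (S I).card) :=
      calc ∑ I ∈ 𝒦, (R I).card ≤ 𝒦.card • (C * (S I).card) :=
            sum_le_card_nsmul _ _ _ fun I' hI' => by
              obtain ⟨J, -, h, -⟩ := hS I' hI'
              exact h.trans (Nat.mul_le_mul_left _ (hmax I' hI'))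
        _ ≤ (m + 1) * (C * (S I).card) := by
            rw [smul_eq_mul]; exact Nat.mul_le_mul_right _ h𝒦
    have hle : F.card ≤ F₀.card + Fintype.card ι * q * ((m + 1) * C) * (S I).card := by
      refine hcard.trans (Nat.add_le_add_left ?_ _)
      calc _ ≤ Fintype.card ι * q * ((m + 1) * (C * (S I).card)) := Nat.mul_le_mul_left _ hsum
        _ = _ := by ring
    rcases le_total F₀.card (S I).card with h | h
    · obtain ⟨J, hJ, -, h2, h3⟩ := hS I hI
      refine ⟨S I, hSF I, J, hJ, hle.trans ?_, h2, h3⟩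
      rw [add_mul 1, one_mul]
      gcongr
    · refine ⟨F₀, hF₀, 𝒦, Subset.rfl, hle.trans ?_,
        fun f hf g hg => hF f (hF₀ hf) g (hF₀ hg), hfull⟩
      rw [add_mul 1, one_mul]
      gcongr

open scoped Classical in
/-- Either a family of functions has size `O(n ^ r)`, or it contains a nonempty subfamily all of
whose members have the same kernels; the set `J` of their domains is closed under intersection and
covers all `r`-sets. -/
theorem card_le_or_exists_homogeneous (ι : Type) [Fintype ι] [DecidableEq ι] (q r : ℕ)
    (hq : 2 * Fintype.card ι ≤ q) :
    ∃ C : ℕ, ∀ (V : Type) [Fintype V] [DecidableEq V] (F : Finset (ι → V)),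
      F.card ≤ C * Fintype.card V ^ r ∨
      ∃ F' ⊆ F, F'.Nonempty ∧ ∃ J : Finset (Finset ι), univ ∉ J ∧
        (∀ I ∈ J, ∀ I' ∈ J, I ∩ I' ∈ J) ∧
        (∀ I : Finset ι, I.card = r → ∃ M ∈ J, I ⊆ M) ∧
        ∀ f ∈ F', ∀ I ∈ J, FunKernel q F' I f := by
  obtain ⟨C, hC⟩ := exists_homogeneous_of_types ι q (univ.erase (univ : Finset ι)).card
  refine ⟨C, fun V _ _ F => ?_⟩
  obtain ⟨F', hF', J, hJ, hcard, hagree, hker⟩ := hC V (univ.erase univ) F le_rfl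
    (fun f _ g _ hfg => by
      simp only [mem_erase, mem_univ, and_true, ne_eq]
      intro h
      exact hfg (funext fun i => mem_agree.1 (h ▸ mem_univ i)))
  have huniv : univ ∉ J := fun h => (mem_erase.1 (hJ h)).1 rfl
  by_cases hcov : ∀ I : Finset ι, I.card = r → ∃ M ∈ J, I ⊆ M
  · rcases F'.eq_empty_or_nonempty with he | hne
    · left
      simp only [he, card_empty, mul_zero, Nat.le_zero] at hcard
      omega
    right
    refine ⟨F', hF', hne, J, huniv, ?_, hcov, hker⟩
    intro I hI I' hI'
    obtain ⟨f, hf⟩ := hne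
    have hcardim : ∀ g : ι → V, (univ.image g).card ≤ Fintype.card ι := fun g => card_image_le
    obtain ⟨g, hg, hg1, hg2⟩ := hker f hf I hI (univ.image f) ((hcardim f).trans (by omega))
    obtain ⟨g', hg', hg1', hg2'⟩ := hker f hf I' hI' (univ.image f ∪ univ.image g)
      ((card_union_le _ _).trans (by have := hcardim f; have := hcardim g; omega))
    have heq : agree g g' = I ∩ I' := by
      ext i
      rw [mem_agree, mem_inter]
      constructor
      · intro h
        have h' : i ∈ I' := by
          by_contra hi
          exact hg2' i hi (by rw [← h]; simp)
        refine ⟨?_, h'⟩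
        by_contra hi
        exact hg2 i hi (by rw [h, hg1' i h']; simp)
      · rintro ⟨h, h'⟩
        rw [hg1 i h, hg1' i h']
    rw [← heq]
    refine hagree g hg g' hg' ?_
    rintro rfl
    have : I = univ := by
      rw [eq_univ_iff_forall]
      intro i
      have hi : i ∈ I ∩ I' := by rw [← heq, mem_agree]
      exact (mem_inter.1 hi).1
    exact huniv (this ▸ hI)
  · left
    push Not at hcov
    obtain ⟨I, hIr, hI⟩ := hcov
    refine hcard.trans (Nat.mul_le_mul_left _ ?_)
    have : F'.card ≤ (univ : Finset (I → V)).card := by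
      refine card_le_card_of_injOn (fun f i => f i) (by simp) ?_
      intro f hf g hg hfg
      by_contra hne
      exact hI _ (hagree f hf g hg hne) fun i hi => mem_agree.2 (congrFun hfg ⟨i, hi⟩)
    simpa [hIr] using this

end Homogeneous

section Kernels

variable {V : Type} [DecidableEq V]

/-- A set `D` is a kernel of `H` of strength `q`: any `q` vertices outside `D` can be avoided by an
edge containing `D`. -/
def Kernel (q : ℕ) (H : Finset (Finset V)) (D : Finset V) : Prop :=
  ∀ Q : Finset V, Q.card ≤ q → Disjoint Q D → ∃ e ∈ H, D ⊆ e ∧ Disjoint e Q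

omit [DecidableEq V] in
lemma kernel_of_mem {q : ℕ} {H : Finset (Finset V)} {e : Finset V} (he : e ∈ H) : Kernel q H e :=
  fun _ _ hd => ⟨e, he, Subset.rfl, hd.symm⟩

lemma FunKernel.kernel {ι : Type} [Fintype ι] {q : ℕ} {F : Finset (ι → V)}
    {H : Finset (Finset V)} {I : Finset ι} {f : ι → V} (h : FunKernel q F I f)
    (hF : ∀ g ∈ F, univ.image g ∈ H) : Kernel q H (I.image f) := by
  intro Q hQ hd
  obtain ⟨g, hg, h1, h2⟩ := h Q hQ
  refine ⟨_, hF g hg, ?_, ?_⟩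
  · intro v hv
    obtain ⟨i, hi, rfl⟩ := mem_image.1 hv
    exact mem_image.2 ⟨i, mem_univ i, h1 i hi⟩
  · rw [disjoint_left]
    intro v hv hvQ
    obtain ⟨i, -, rfl⟩ := mem_image.1 hv
    by_cases hi : i ∈ I
    · exact disjoint_left.1 hd hvQ (mem_image.2 ⟨i, hi, (h1 i hi).symm⟩)
    · exact h2 i hi hvQ

/-- A cyclic list of sets such that consecutive ones meet in one element and nonconsecutive ones
are disjoint. -/
structure IsLinearCyclic {ℓ : ℕ} (A : ZMod ℓ → Finset V) : Prop where
  card_inter : ∀ i, (A i ∩ A (i + 1)).card = 1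
  disjoint : ∀ i j, j ≠ i → j ≠ i + 1 → i ≠ j + 1 → Disjoint (A i) (A j)

/-- A linear cycle of kernels expands to a linear cycle of edges. -/
theorem exists_linearCyclic_of_kernel {k ℓ q : ℕ} [NeZero ℓ] {H : Finset (Finset V)}
    (hℓ : 2 ≤ ℓ) (hH : ∀ e ∈ H, e.card = k) (hq : k * ℓ ≤ q) {K : ZMod ℓ → Finset V}
    (hK : IsLinearCyclic K) (hker : ∀ i, Kernel q H (K i)) :
    ∃ A : ZMod ℓ → Finset V, IsLinearCyclic A ∧ ∀ i, A i ∈ H := by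
  have hone : ∀ i : ZMod ℓ, i + 1 ≠ i := by
    intro i h
    have : Fact (1 < ℓ) := ⟨by omega⟩
    exact one_ne_zero (add_eq_left.1 h)
  suffices h : ∀ T : Finset (ZMod ℓ), ∃ A : ZMod ℓ → Finset V, IsLinearCyclic A ∧
      (∀ i, Kernel q H (A i)) ∧ ∀ i ∈ T, A i ∈ H by
    obtain ⟨A, h1, -, h2⟩ := h univ
    exact ⟨A, h1, fun i => h2 i (mem_univ i)⟩
  intro T
  induction T using Finset.induction with
  | empty => exact ⟨K, hK, hker, by simp⟩
  | insert j T hj ih =>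
    obtain ⟨A, hA, hAk, hAT⟩ := ih
    have hcard : ∀ i, (A i).card ≤ k := by
      intro i
      obtain ⟨e, he, hs, -⟩ := hAk i ∅ (by simp) (by simp)
      exact (card_le_card hs).trans (hH e he).le
    obtain ⟨e, he, hs, hd⟩ := hAk j ((univ.biUnion A) \ A j) (by
      calc _ ≤ (univ.biUnion A).card := card_le_card sdiff_subset
        _ ≤ ∑ i, (A i).card := card_biUnion_le
        _ ≤ ∑ _i : ZMod ℓ, k := sum_le_sum fun i _ => hcard i
        _ = k * ℓ := by simp [ZMod.card, mul_comm]
        _ ≤ q := hq) sdiff_disjoint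
    have hinter : ∀ i, e ∩ A i = A j ∩ A i := by
      intro i
      ext v
      simp only [mem_inter, and_congr_left_iff]
      refine fun hv => ⟨fun hve => ?_, fun h => hs h⟩
      by_contra hvj
      exact disjoint_left.1 hd hve (mem_sdiff.2 ⟨mem_biUnion.2 ⟨i, mem_univ i, hv⟩, hvj⟩)
    refine ⟨Function.update A j e, ⟨?_, ?_⟩, ?_, ?_⟩
    · intro i
      by_cases hi : i = j
      · subst hi
        rw [Function.update_self, Function.update_of_ne (hone i), hinter]
        exact hA.card_inter i
      · rw [Function.update_of_ne hi]
        by_cases hi' : i + 1 = j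
        · subst hi'
          rw [Function.update_self, inter_comm, hinter, inter_comm]
          exact hA.card_inter i
        · rw [Function.update_of_ne hi']
          exact hA.card_inter i
    · intro i i' h1 h2 h3
      have := hA.disjoint i i' h1 h2 h3
      rw [disjoint_iff_inter_eq_empty] at this ⊢
      by_cases hi : i = j
      · subst hi
        rw [Function.update_self, Function.update_of_ne h1, hinter, this]
      · rw [Function.update_of_ne hi]
        by_cases hi' : i' = j
        · subst hi'
          rw [Function.update_self, inter_comm, hinter, inter_comm, this]
        · rw [Function.update_of_ne hi', this]
    · intro i
      by_cases hi : i = j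
      · subst hi
        rw [Function.update_self]
        exact kernel_of_mem he
      · rw [Function.update_of_ne hi]
        exact hAk i
    · intro i hi
      by_cases hij : i = j
      · subst hij
        rwa [Function.update_self]
      · rw [Function.update_of_ne hij]
        exact hAT i (mem_of_mem_insert_of_ne hi hij)

lemma isLinearCyclic_of_nat {N : ℕ} (hN : 2 ≤ N) {κ : ℕ → Finset V}
    (h1 : ∀ m, m + 1 < N → (κ m ∩ κ (m + 1)).card = 1) (h2 : (κ (N - 1) ∩ κ 0).card = 1)
    (h3 : ∀ m m', m + 1 < m' → m' < N → ¬ (m = 0 ∧ m' + 1 = N) → Disjoint (κ m) (κ m')) :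
    IsLinearCyclic fun i : ZMod N => κ i.val := by
  have : NeZero N := ⟨by omega⟩
  have hcast : ∀ i : ZMod N, ((i.val : ℕ) : ZMod N) = i := fun i => ZMod.natCast_zmod_val i
  have hsucc : ∀ i j : ZMod N, j.val = i.val + 1 → j = i + 1 := by
    intro i j h
    rw [← hcast j, h, Nat.cast_add, hcast, Nat.cast_one]
  have hlast : ∀ i j : ZMod N, i.val = 0 → j.val + 1 = N → i = j + 1 := by
    intro i j hi hj
    rw [← hcast i, hi, ← hcast j, ← Nat.cast_succ, Nat.succ_eq_add_one, hj]
    simp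
  constructor
  · intro i
    by_cases hi : i.val + 1 < N
    · have : (i + 1).val = i.val + 1 := by
        have := ZMod.val_natCast_of_lt hi
        rwa [Nat.cast_add, hcast, Nat.cast_one] at this
      simp only [this]
      exact h1 _ hi
    · have hi' : i.val + 1 = N := by have := ZMod.val_lt i; omega
      have : (i + 1).val = 0 := by
        rw [← hlast 0 i (by simp) hi']
        simp
      simp only [this]
      rw [show i.val = N - 1 by omega]
      exact h2
  · have key : ∀ i j : ZMod N, i.val < j.val → j ≠ i + 1 → i ≠ j + 1 →
        Disjoint (κ i.val) (κ j.val) := by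
      intro i j hij hj hi
      refine h3 _ _ ?_ (ZMod.val_lt j) fun h => hi (hlast i j h.1 h.2)
      have : j.val ≠ i.val + 1 := fun h => hj (hsucc i j h)
      omega
    intro i j hij hj hi
    rcases lt_trichotomy i.val j.val with h | h | h
    · exact key i j h hj hi
    · exact absurd (ZMod.val_injective N h).symm hij
    · exact (key j i h hi hj).symm

/-- The graph of kernels of size two. -/
def kernelGraph (q : ℕ) (H : Finset (Finset V)) : SimpleGraph V where
  Adj u v := u ≠ v ∧ Kernel q H {u, v}
  symm := ⟨fun u v h => ⟨h.1.symm, by rw [pair_comm]; exact h.2⟩⟩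
  loopless := ⟨fun _ h => h.1 rfl⟩

/-- A path of kernel pairs of length `2 * t` closed by two kernels meeting in one vertex gives a
linear cycle of length `2 * t + 2`. -/
theorem exists_linearCyclic_of_isPath {k t q : ℕ} {H : Finset (Finset V)} (ht : 1 ≤ t)
    (hH : ∀ e ∈ H, e.card = k) (hq : k * (2 * t + 2) ≤ q) {a b : V}
    (w : (kernelGraph q H).Walk a b) (hw : w.IsPath) (hlen : w.length = 2 * t)
    {E F : Finset V} {v : V} (hE : Kernel q H E) (hF : Kernel q H F) (hEF : E ∩ F = {v})
    (hEw : ∀ u ∈ w.support, u ∈ E ↔ u = b) (hFw : ∀ u ∈ w.support, u ∈ F ↔ u = a) :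
    ∃ A : ZMod (2 * t + 2) → Finset V, IsLinearCyclic A ∧ ∀ i, A i ∈ H := by
  have hinj : ∀ i j, i ≤ 2 * t → j ≤ 2 * t → w.getVert i = w.getVert j → i = j := by
    intro i j hi hj h
    exact hw.getVert_injOn (by simpa [hlen] using hi) (by simpa [hlen] using hj) h
  have hend : w.getVert (2 * t) = b := by rw [← hlen, w.getVert_length]
  have hEw' : ∀ i ≤ 2 * t, w.getVert i ∈ E ↔ i = 2 * t := by
    intro i hi
    rw [hEw _ (w.getVert_mem_support i)]
    exact ⟨fun h => hinj i _ hi le_rfl (h.trans hend.symm), fun h => h ▸ hend⟩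
  have hFw' : ∀ i ≤ 2 * t, w.getVert i ∈ F ↔ i = 0 := by
    intro i hi
    rw [hFw _ (w.getVert_mem_support i)]
    exact ⟨fun h => hinj i _ hi (by omega) (h.trans w.getVert_zero.symm),
      fun h => h ▸ w.getVert_zero⟩
  let κ : ℕ → Finset V := fun m =>
    if m < 2 * t then {w.getVert m, w.getVert (m + 1)} else if m = 2 * t then E else F
  have hκ1 : ∀ m < 2 * t, κ m = {w.getVert m, w.getVert (m + 1)} := fun m hm => by simp [κ, hm]
  have hκ2 : κ (2 * t) = E := by simp [κ]
  have hκ3 : κ (2 * t + 1) = F := by simp [κ]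
  refine exists_linearCyclic_of_kernel (K := fun i => κ i.val) (by omega) hH hq
    (isLinearCyclic_of_nat (by omega) ?_ ?_ ?_) ?_
  · intro m hm
    rcases lt_trichotomy (m + 1) (2 * t) with h | h | h
    · rw [hκ1 m (by omega), hκ1 (m + 1) h, card_eq_one]
      refine ⟨w.getVert (m + 1), ?_⟩
      have e1 := hinj m (m + 1) (by omega) (by omega)
      have e2 := hinj m (m + 1 + 1) (by omega) (by omega)
      ext u
      simp only [mem_inter, mem_insert, mem_singleton]
      grind
    · rw [hκ1 m (by omega), h, hκ2, card_eq_one]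
      refine ⟨b, ?_⟩
      have e1 := hEw' m (by omega)
      have e2 := hEw' (m + 1) (by omega)
      ext u
      simp only [mem_inter, mem_insert, mem_singleton]
      grind
    · obtain rfl : m = 2 * t := by omega
      rw [hκ2, hκ3, hEF, card_singleton]
  · rw [show 2 * t + 2 - 1 = 2 * t + 1 by omega, hκ3, hκ1 0 (by omega), card_eq_one]
    refine ⟨a, ?_⟩
    have e1 := hFw' 0 (by omega)
    have e2 := hFw' (0 + 1) (by omega)
    have e3 := w.getVert_zero
    ext u
    simp only [mem_inter, mem_insert, mem_singleton]
    grind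
  · intro m m' hm hm' hne
    rw [hκ1 m (by omega), disjoint_left]
    intro u hu hu'
    simp only [mem_insert, mem_singleton] at hu
    rcases lt_trichotomy m' (2 * t) with h | h | h
    · rw [hκ1 m' h] at hu'
      simp only [mem_insert, mem_singleton] at hu'
      have e1 := hinj m m' (by omega) (by omega)
      have e2 := hinj (m + 1) m' (by omega) (by omega)
      have e3 := hinj m (m' + 1) (by omega) (by omega)
      have e4 := hinj (m + 1) (m' + 1) (by omega) (by omega)
      grind
    · rw [h, hκ2] at hu'
      have e1 := hEw' m (by omega)
      have e2 := hEw' (m + 1) (by omega)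
      grind
    · obtain rfl : m' = 2 * t + 1 := by omega
      rw [hκ3] at hu'
      have e1 := hFw' m (by omega)
      have e2 := hFw' (m + 1) (by omega)
      grind
  · intro i
    have hi := ZMod.val_lt i
    by_cases h : i.val < 2 * t
    · simp only [hκ1 _ h]
      exact (w.adj_getVert_succ (by omega)).2
    · rcases Nat.lt_or_ge (2 * t) i.val with h' | h'
      · simp only [show i.val = 2 * t + 1 by omega, hκ3]
        exact hF
      · simp only [show i.val = 2 * t by omega, hκ2]
        exact hE

/-- A closed version: a path of kernel pairs of length `2 * t` whose ends are joined to a further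
vertex gives a linear cycle of length `2 * t + 2`. -/
theorem exists_linearCyclic_of_isPath_of_adj {k t q : ℕ} {H : Finset (Finset V)} (ht : 1 ≤ t)
    (hH : ∀ e ∈ H, e.card = k) (hq : k * (2 * t + 2) ≤ q) {a b z : V}
    (w : (kernelGraph q H).Walk a b) (hw : w.IsPath) (hlen : w.length = 2 * t)
    (hz : z ∉ w.support) (hza : (kernelGraph q H).Adj z a) (hzb : (kernelGraph q H).Adj z b) :
    ∃ A : ZMod (2 * t + 2) → Finset V, IsLinearCyclic A ∧ ∀ i, A i ∈ H := by
  have hab : a ≠ b := by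
    rintro rfl
    rw [SimpleGraph.Walk.isPath_iff_nil, ← SimpleGraph.Walk.length_eq_zero_iff] at hw
    omega
  refine exists_linearCyclic_of_isPath ht hH hq w hw hlen hzb.2 hza.2 (v := z) ?_ ?_ ?_
  · have := hza.1
    have := hzb.1
    ext u
    simp only [mem_inter, mem_insert, mem_singleton]
    grind
  · intro u hu
    simp only [mem_insert, mem_singleton]
    grind
  · intro u hu
    simp only [mem_insert, mem_singleton]
    grind

end Kernels

section Classification

variable {ι : Type} [Fintype ι] [DecidableEq ι]

/-- The union-closedness of the complements of an intersection-closed family. -/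
lemma compl_union_mem {J : Finset (Finset ι)} (hJ : ∀ I ∈ J, ∀ I' ∈ J, I ∩ I' ∈ J)
    {Z Z' : Finset ι} (hZ : Zᶜ ∈ J) (hZ' : Z'ᶜ ∈ J) : (Z ∪ Z')ᶜ ∈ J := by
  rw [compl_union]
  exact hJ _ hZ _ hZ'

lemma compl_biUnion_mem {J : Finset (Finset ι)} (hJ : ∀ I ∈ J, ∀ I' ∈ J, I ∩ I' ∈ J)
    {α : Type} [DecidableEq α] {s : Finset α} (hs : s.Nonempty) {Z : α → Finset ι}
    (hZ : ∀ a ∈ s, (Z a)ᶜ ∈ J) : (s.biUnion Z)ᶜ ∈ J := by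
  induction hs using Finset.Nonempty.cons_induction with
  | singleton a => simpa using hZ a
  | cons a s ha hs ih =>
    rw [cons_eq_insert, biUnion_insert]
    exact compl_union_mem hJ (hZ a (by simp)) (ih fun b hb => hZ b (by simp [hb]))

/-- A set is a union of members as soon as each of its elements lies in a member inside it. -/
lemma compl_mem_of_cover {J : Finset (Finset ι)} (hJ : ∀ I ∈ J, ∀ I' ∈ J, I ∩ I' ∈ J)
    {U : Finset ι} (hU : U.Nonempty) (h : ∀ x ∈ U, ∃ Z ⊆ U, x ∈ Z ∧ Zᶜ ∈ J) : Uᶜ ∈ J := by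
  choose! Z hZ1 hZ2 hZ3 using h
  have : U = U.biUnion Z := by
    ext x
    simp only [mem_biUnion]
    exact ⟨fun hx => ⟨x, hx, hZ2 x hx⟩, fun ⟨y, hy, hx⟩ => hZ1 y hy hx⟩
  rw [this]
  exact compl_biUnion_mem hJ hU hZ3

/-- Covering the `(k - j)`-sets by members means that the `j`-sets contain nonempty complements. -/
lemma exists_compl_subset {J : Finset (Finset ι)} (hu : univ ∉ J) {r : ℕ}
    (hr : ∀ I : Finset ι, I.card = r → ∃ M ∈ J, I ⊆ M) {A : Finset ι}
    (hA : A.card + r = Fintype.card ι) : ∃ Z ⊆ A, Z.Nonempty ∧ Zᶜ ∈ J := by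
  obtain ⟨M, hM, hsub⟩ := hr Aᶜ (by rw [card_compl]; omega)
  refine ⟨Mᶜ, fun x hx => ?_, ?_, by simpa using hM⟩
  · by_contra h
    exact mem_compl.1 hx (hsub (mem_compl.2 h))
  rw [nonempty_iff_ne_empty]
  intro h
  rw [compl_eq_empty_iff] at h
  exact hu (h ▸ hM)

/-- Classification of intersection-closed families covering all `(k - 2)`-sets: they contain a
star of pairs or a triangle of pairs. -/
theorem star_or_triangle {J : Finset (Finset ι)} (hk : 5 ≤ Fintype.card ι)
    (hu : univ ∉ J) (hJ : ∀ I ∈ J, ∀ I' ∈ J, I ∩ I' ∈ J)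
    (hr : ∀ I : Finset ι, I.card = Fintype.card ι - 2 → ∃ M ∈ J, I ⊆ M) :
    (∃ c, ∀ y, y ≠ c → {c, y} ∈ J) ∨
      ∃ a b c, a ≠ b ∧ a ≠ c ∧ b ≠ c ∧ {a, b} ∈ J ∧ {a, c} ∈ J ∧ {b, c} ∈ J := by
  set X : Finset ι := univ.filter fun x => ({x} : Finset ι)ᶜ ∈ J with hX
  have hpair : ∀ y y', y ∉ X → y' ∉ X → y ≠ y' → ({y, y'} : Finset ι)ᶜ ∈ J := by
    intro y y' hy hy' hne
    obtain ⟨Z, hZ, hZn, hZJ⟩ := exists_compl_subset hu hr (A := {y, y'})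
      (by rw [card_pair hne]; omega)
    simp only [hX, mem_filter, mem_univ, true_and] at hy hy'
    have : Z = {y} ∨ Z = {y'} ∨ Z = {y, y'} := by
      obtain ⟨z, hz⟩ := hZn
      simp only [Finset.ext_iff, subset_iff, mem_insert, mem_singleton] at hZ ⊢
      grind
    rcases this with rfl | rfl | rfl
    · exact absurd hZJ hy
    · exact absurd hZJ hy'
    · exact hZJ
  have key : ∀ P : Finset ι, Pᶜ.Nonempty → (∀ y, y ∉ P → y ∉ X → ∃ y', y' ≠ y ∧ y' ∉ P ∧ y' ∉ X) →
      P ∈ J := by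
    intro P hP h
    rw [← compl_compl P]
    refine compl_mem_of_cover hJ hP fun y hy => ?_
    rw [mem_compl] at hy
    by_cases hyX : y ∈ X
    · refine ⟨{y}, by simpa using hy, by simp, ?_⟩
      simpa [hX] using hyX
    · obtain ⟨y', h1, h2, h3⟩ := h y hy hyX
      refine ⟨{y, y'}, ?_, by simp, hpair y y' hyX h3 h1.symm⟩
      intro u hu
      simp only [mem_insert, mem_singleton] at hu
      rw [mem_compl]
      rcases hu with rfl | rfl <;> assumption
  have hcomp : ∀ a b : ι, ({a, b} : Finset ι)ᶜ.Nonempty := by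
    intro a b
    rw [← card_pos, card_compl]
    have := card_le_two (a := a) (b := b)
    omega
  by_cases h1 : Xᶜ.card ≤ 1
  · left
    obtain ⟨c, hc⟩ : ∃ c, Xᶜ ⊆ {c} := by
      rcases Xᶜ.eq_empty_or_nonempty with h | ⟨c, hc⟩
      · have : Nonempty ι := Fintype.card_pos_iff.1 (by omega)
        exact ⟨this.some, by simp [h]⟩
      · exact ⟨c, fun d hd => by rw [mem_singleton]; exact card_le_one.1 h1 d hd c hc⟩
    refine ⟨c, fun y _ => key _ (hcomp _ _) fun u hu huX => ?_⟩
    have := hc (mem_compl.2 huX)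
    simp only [mem_singleton] at this
    simp [this] at hu
  right
  have h3X : ∀ a b, (∃ u v, u ≠ v ∧ u ∉ X ∧ v ∉ X ∧ u ∉ ({a, b} : Finset ι) ∧
      v ∉ ({a, b} : Finset ι)) → ({a, b} : Finset ι) ∈ J := by
    rintro a b ⟨u, v, huv, hu, hv, hu', hv'⟩
    refine key _ (hcomp _ _) fun y hy hyX => ?_
    by_cases hyu : y = u
    · exact ⟨v, fun h => huv (hyu ▸ h.symm), hv', hv⟩
    · exact ⟨u, fun h => hyu h.symm, hu', hu⟩
  by_cases h3 : 2 < X.card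
  · obtain ⟨a, ha, b, hb, c, hc, hab, hac, hbc⟩ := two_lt_card.1 h3
    obtain ⟨u, hu, v, hv, huv⟩ := one_lt_card.1 (by omega : 1 < Xᶜ.card)
    rw [mem_compl] at hu hv
    refine ⟨a, b, c, hab, hac, hbc, ?_, ?_, ?_⟩ <;>
      refine h3X _ _ ⟨u, v, huv, hu, hv, ?_, ?_⟩ <;>
      simp only [mem_insert, mem_singleton, not_or] <;> constructor <;> rintro rfl <;> contradiction
  · have hXY := card_add_card_compl X
    by_cases h4 : 4 ≤ Xᶜ.card
    · obtain ⟨s, hs, hs3⟩ := exists_subset_card_eq (show 3 ≤ Xᶜ.card by omega)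
      obtain ⟨a, b, c, hab, hac, hbc, rfl⟩ := card_eq_three.1 hs3
      have hd : ∃ d ∈ Xᶜ, d ∉ ({a, b, c} : Finset ι) := by
        by_contra! h
        have := card_le_card h
        omega
      obtain ⟨d, hd, hd'⟩ := hd
      simp only [insert_subset_iff, singleton_subset_iff, mem_compl] at hs hd
      simp only [mem_insert, mem_singleton, not_or] at hd'
      refine ⟨a, b, c, hab, hac, hbc, h3X _ _ ⟨c, d, ?_⟩, h3X _ _ ⟨b, d, ?_⟩,
        h3X _ _ ⟨a, d, ?_⟩⟩ <;> grind
    · obtain ⟨a, b, c, hab, hac, hbc, hY⟩ := card_eq_three.1 (by omega : Xᶜ.card = 3)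
      obtain ⟨u, v, huv, hXe⟩ := card_eq_two.1 (by omega : X.card = 2)
      have hbX : b ∉ X := by rw [← mem_compl, hY]; simp
      have hcX : c ∉ X := by rw [← mem_compl, hY]; simp
      have haX : a ∉ X := by rw [← mem_compl, hY]; simp
      have huX : u ∈ X := by rw [hXe]; simp
      have hvX : v ∈ X := by rw [hXe]; simp
      refine ⟨a, u, v, fun h => haX (h ▸ huX), fun h => haX (h ▸ hvX), huv, ?_, ?_, ?_⟩ <;>
        refine h3X _ _ ⟨b, c, hbc, hbX, hcX, ?_, ?_⟩ <;>
        rw [mem_insert, mem_singleton, not_or] <;> constructor <;> rintro rfl <;> contradiction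

open scoped Classical in
/-- The union of the complements of members of `J` that are contained in `A`. -/
def core (J : Finset (Finset ι)) (A : Finset ι) : Finset ι :=
  univ.filter fun x => ∃ Z ⊆ A, x ∈ Z ∧ Zᶜ ∈ J

lemma mem_core {J : Finset (Finset ι)} {A : Finset ι} {x : ι} :
    x ∈ core J A ↔ ∃ Z ⊆ A, x ∈ Z ∧ Zᶜ ∈ J := by simp [core]

lemma card_sdiff_core_le_one {J : Finset (Finset ι)} (hu : univ ∉ J) (hk : 3 ≤ Fintype.card ι)
    (hr : ∀ I : Finset ι, I.card = Fintype.card ι - 3 → ∃ M ∈ J, I ⊆ M) {A : Finset ι}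
    (hA : 3 ≤ A.card) (hs : ∀ x ∈ A, ({x} : Finset ι)ᶜ ∉ J) : (A \ core J A).card ≤ 1 := by
  by_contra! h
  obtain ⟨a, ha, b, hb, hab⟩ := one_lt_card.1 h
  rw [mem_sdiff] at ha hb
  obtain ⟨c, hc, hcab⟩ : ∃ c ∈ A, c ∉ ({a, b} : Finset ι) := by
    by_contra! h
    have := (card_le_card h).trans card_le_two
    omega
  simp only [mem_insert, mem_singleton, not_or] at hcab
  obtain ⟨Z, hZ, ⟨z, hz⟩, hZJ⟩ := exists_compl_subset hu hr (A := {a, b, c})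
    (by rw [card_eq_three.2 ⟨a, b, c, hab, Ne.symm hcab.1, Ne.symm hcab.2, rfl⟩]; omega)
  have hZA : Z ⊆ A := hZ.trans (by simp [insert_subset_iff, ha.1, hb.1, hc])
  have hZc : ∀ x ∈ Z, x = c := by
    intro x hx
    have h1 : x ∈ core J A := mem_core.2 ⟨Z, hZA, hx, hZJ⟩
    have h2 := hZ hx
    simp only [mem_insert, mem_singleton] at h2
    rcases h2 with rfl | rfl | rfl
    · exact absurd h1 ha.2
    · exact absurd h1 hb.2
    · rfl
  have : Z = {c} := eq_singleton_iff_unique_mem.2 ⟨hZc z hz ▸ hz, hZc⟩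
  exact hs c hc (this ▸ hZJ)

/-- Classification of intersection-closed families without singletons covering all
`(k - 3)`-sets: some pair has all its proper supersets in the family. -/
theorem exists_pair_forall_superset_mem {J : Finset (Finset ι)} (hk : 5 ≤ Fintype.card ι)
    (hu : univ ∉ J) (hJ : ∀ I ∈ J, ∀ I' ∈ J, I ∩ I' ∈ J) (h1 : ∀ x : ι, {x} ∉ J)
    (hr : ∀ I : Finset ι, I.card = Fintype.card ι - 3 → ∃ M ∈ J, I ⊆ M) :
    ∃ a b, a ≠ b ∧ ∀ I : Finset ι, a ∈ I → b ∈ I → I ≠ univ → I ∈ J := by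
  set Y : Finset ι := univ.filter fun x => ({x} : Finset ι)ᶜ ∉ J with hY
  have hYmem : ∀ x, x ∈ Y ↔ ({x} : Finset ι)ᶜ ∉ J := by simp [hY]
  have hnot : ∀ y : ι, ¬ ∀ x, x ≠ y → ∃ Z : Finset ι, y ∉ Z ∧ x ∈ Z ∧ Zᶜ ∈ J := by
    intro y h
    apply h1 y
    rw [← compl_compl ({y} : Finset ι)]
    refine compl_mem_of_cover hJ ?_ fun x hx => ?_
    · rw [← card_pos, card_compl, card_singleton]
      omega
    · obtain ⟨Z, hZ, hx, hZJ⟩ := h x (by simpa using hx)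
      refine ⟨Z, fun z hz => ?_, hx, hZJ⟩
      rw [mem_compl, mem_singleton]
      rintro rfl
      exact hZ hz
  by_cases hY2 : Y.card ≤ 2
  · obtain ⟨P, hP, hP2⟩ := exists_superset_card_eq hY2 (by omega)
    obtain ⟨a, b, hab, rfl⟩ := card_eq_two.1 hP2
    refine ⟨a, b, hab, fun I ha hb hI => ?_⟩
    rw [← compl_compl I]
    refine compl_mem_of_cover hJ ?_ fun x hx => ?_
    · rw [nonempty_iff_ne_empty, ne_eq, compl_eq_empty_iff]
      exact hI
    · refine ⟨{x}, by simpa using hx, by simp, ?_⟩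
      by_contra h
      have := hP ((hYmem x).2 h)
      simp only [mem_insert, mem_singleton] at this
      rw [mem_compl] at hx
      rcases this with rfl | rfl <;> contradiction
  exfalso
  push Not at hY2
  have hTY := card_sdiff_core_le_one hu (by omega) hr hY2 fun x hx => (hYmem x).1 hx
  have hTY' : Y ⊆ core J Y := by
    intro y hy
    by_contra hyT
    refine hnot y fun x hx => ?_
    by_cases hxY : x ∈ Y
    · have : x ∈ core J Y := by
        by_contra hxT
        exact hx (card_le_one.1 hTY _ (mem_sdiff.2 ⟨hxY, hxT⟩) _ (mem_sdiff.2 ⟨hy, hyT⟩))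
      obtain ⟨Z, hZ, hxZ, hZJ⟩ := mem_core.1 this
      exact ⟨Z, fun h => hyT (mem_core.2 ⟨Z, hZ, h, hZJ⟩), hxZ, hZJ⟩
    · refine ⟨{x}, by simpa using hx.symm, by simp, ?_⟩
      by_contra h
      exact hxY ((hYmem x).2 h)
  have hYuniv : ∀ x, x ∈ Y := by
    intro x
    by_contra hxY
    refine hnot x fun y hy => ?_
    by_cases hyY : y ∈ Y
    · obtain ⟨Z, hZ, hyZ, hZJ⟩ := mem_core.1 (hTY' hyY)
      exact ⟨Z, fun h => hxY (hZ h), hyZ, hZJ⟩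
    · refine ⟨{y}, by simpa using hy.symm, by simp, ?_⟩
      by_contra h
      exact hyY ((hYmem y).2 h)
  have hs : ∀ x, ({x} : Finset ι)ᶜ ∉ J := fun x => (hYmem x).1 (hYuniv x)
  have hUv : ∀ v, ∃ a, a ≠ v ∧ (∀ Z : Finset ι, Zᶜ ∈ J → v ∉ Z → a ∉ Z) ∧
      ∀ x, x ≠ a → x ≠ v → ∃ Z : Finset ι, v ∉ Z ∧ x ∈ Z ∧ Zᶜ ∈ J := by
    intro v
    have hc := card_sdiff_core_le_one hu (by omega) hr (A := {v}ᶜ)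
      (by rw [card_compl, card_singleton]; omega) fun x _ => hs x
    have hex := hnot v
    push Not at hex
    obtain ⟨a, hav, ha⟩ := hex
    refine ⟨a, hav, fun Z hZ hv haZ => ha Z hv haZ hZ, fun x hxa hxv => ?_⟩
    have hxc : x ∈ core J {v}ᶜ := by
      by_contra hxc
      refine hxa (card_le_one.1 hc _ (mem_sdiff.2 ⟨by simpa using hxv, hxc⟩) _
        (mem_sdiff.2 ⟨by simpa using hav, fun h => ?_⟩))
      obtain ⟨Z, hZ, haZ, hZJ⟩ := mem_core.1 h
      exact ha Z (fun h => by simpa using hZ h) haZ hZJ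
    obtain ⟨Z, hZ, haZ, hZJ⟩ := mem_core.1 hxc
    exact ⟨Z, fun h => by simpa using hZ h, haZ, hZJ⟩
  choose a hav ha1 ha2 using hUv
  have hpair : ∀ v x y, x ≠ y → x ≠ v → y ≠ v → x ≠ a v → y ≠ a v →
      ({x, y} : Finset ι)ᶜ ∈ J := by
    intro v x y hxy hxv hyv hxa hya
    obtain ⟨Z, hZ, ⟨z, hz⟩, hZJ⟩ := exists_compl_subset hu hr (A := {a v, x, y})
      (by rw [card_eq_three.2 ⟨a v, x, y, hxa.symm, hya.symm, hxy, rfl⟩]; omega)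
    have hv : v ∉ Z := fun h => by
      have := hZ h
      simp only [mem_insert, mem_singleton] at this
      have := hav v
      grind
    have haZ := ha1 v Z hZJ hv
    have : Z = {x} ∨ Z = {y} ∨ Z = {x, y} := by
      simp only [Finset.ext_iff, subset_iff, mem_insert, mem_singleton] at hZ ⊢
      grind
    rcases this with rfl | rfl | rfl
    · exact absurd hZJ (hs x)
    · exact absurd hZJ (hs y)
    · exact hZJ
  have hmore : ∀ s : Finset ι, s.card ≤ 4 → ∃ x, x ∉ s := by
    intro s h
    by_contra! hcon
    rw [← eq_univ_iff_forall] at hcon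
    rw [hcon, card_univ] at h
    omega
  obtain ⟨v⟩ : Nonempty ι := Fintype.card_pos_iff.1 (by omega)
  obtain ⟨v', hv'⟩ := hmore {v, a v} (card_le_two.trans (by omega))
  simp only [mem_insert, mem_singleton, not_or] at hv'
  obtain ⟨p, hp⟩ := hmore {v, a v, v'} (card_le_three.trans (by omega))
  simp only [mem_insert, mem_singleton, not_or] at hp
  have hcase : a v' = v ∨ a v' = a v := by
    by_contra! hcon
    obtain ⟨r, hr⟩ := hmore {v, a v, v', a v'} card_le_four
    simp only [mem_insert, mem_singleton, not_or] at hr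
    have h := hpair v (a v') r (Ne.symm hr.2.2.2) hcon.1 hr.1 hcon.2 hr.2.1
    refine ha1 v' _ h ?_ (by simp)
    rw [mem_insert, mem_singleton, not_or]
    exact ⟨(hav v').symm, Ne.symm hr.2.2.1⟩
  rcases hcase with h | h
  · have h' := hpair v' (a v) p (Ne.symm hp.2.1) (Ne.symm hv'.2) hp.2.2 (by rw [h]; exact hav v)
      (by rw [h]; exact hp.1)
    refine ha1 v _ h' ?_ (by simp)
    rw [mem_insert, mem_singleton, not_or]
    exact ⟨(hav v).symm, Ne.symm hp.1⟩
  · have h' := hpair v' v p (Ne.symm hp.1) (Ne.symm hv'.1) hp.2.2 (by rw [h]; exact (hav v).symm)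
      (by rw [h]; exact hp.2.1)
    refine hnot (a v) fun x hx => ?_
    by_cases hxv : x = v
    · refine ⟨{v, p}, ?_, by simp [hxv], h'⟩
      rw [mem_insert, mem_singleton, not_or]
      exact ⟨hav v, Ne.symm hp.2.1⟩
    · obtain ⟨Z, hZ, hxZ, hZJ⟩ := ha2 v x hx hxv
      exact ⟨Z, ha1 v Z hZJ hZ, hxZ, hZJ⟩

end Classification

section Enumerations

variable {ι V : Type} [Fintype ι] [DecidableEq V]

lemma exists_enumeration {e : Finset V} (he : e.card = Fintype.card ι) :
    ∃ f : ι → V, Function.Injective f ∧ univ.image f = e := by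
  have e1 : ι ≃ e := Fintype.equivOfCardEq (by simp [he])
  refine ⟨fun i => e1 i, fun i j h => e1.injective (Subtype.ext h), ?_⟩
  ext v
  simp only [mem_image, mem_univ, true_and]
  exact ⟨fun ⟨i, hi⟩ => hi ▸ (e1 i).2, fun hv => ⟨e1.symm ⟨v, hv⟩, by simp⟩⟩

open scoped Classical in
/-- The injective enumerations of the members of `T`. -/
noncomputable def enumerations (ι : Type) [Fintype ι] [Fintype V] (T : Finset (Finset V)) :
    Finset (ι → V) :=
  univ.filter fun f => Function.Injective f ∧ univ.image f ∈ T

lemma mem_enumerations [Fintype V] {T : Finset (Finset V)} {f : ι → V} :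
    f ∈ enumerations ι T ↔ Function.Injective f ∧ univ.image f ∈ T := by simp [enumerations]

lemma card_le_card_enumerations [Fintype V] {T : Finset (Finset V)}
    (hT : ∀ e ∈ T, e.card = Fintype.card ι) : T.card ≤ (enumerations ι T).card := by
  calc T.card ≤ ((enumerations ι T).image fun f => univ.image f).card := by
        refine card_le_card fun e he => ?_
        obtain ⟨f, hf, rfl⟩ := exists_enumeration (hT e he)
        exact mem_image.2 ⟨f, mem_enumerations.2 ⟨hf, he⟩, rfl⟩
    _ ≤ _ := card_image_le

end Enumerations

section Centres

variable {ι V : Type} [Fintype ι] [DecidableEq ι] [DecidableEq V]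

lemma FunKernel.adj {q : ℕ} {F : Finset (ι → V)} {H : Finset (Finset V)} {f : ι → V} {i j : ι}
    (h : FunKernel q F {i, j} f) (hF : ∀ g ∈ F, univ.image g ∈ H) (hne : f i ≠ f j) :
    (kernelGraph q H).Adj (f i) (f j) := by
  refine ⟨hne, ?_⟩
  have := h.kernel hF
  rwa [image_insert, image_singleton] at this

/-- A homogeneous family with a triangle of kernel pairs yields a linear cycle. -/
theorem exists_linearCyclic_of_triangle {k t q : ℕ} {H : Finset (Finset V)} (ht : 1 ≤ t)
    (hH : ∀ e ∈ H, e.card = k) (hq : k * (2 * t + 2) ≤ q) (hq' : 2 * t + 2 ≤ q)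
    {F : Finset (ι → V)} (hne : F.Nonempty) (hF : ∀ g ∈ F, univ.image g ∈ H)
    (hinj : ∀ g ∈ F, Function.Injective g) {a b c : ι} (hab : a ≠ b) (hac : a ≠ c) (hbc : b ≠ c)
    (h1 : ∀ f ∈ F, FunKernel q F {a, b} f) (h2 : ∀ f ∈ F, FunKernel q F {a, c} f)
    (h3 : ∀ f ∈ F, FunKernel q F {b, c} f) :
    ∃ A : ZMod (2 * t + 2) → Finset V, IsLinearCyclic A ∧ ∀ i, A i ∈ H := by
  obtain ⟨f₀, hf₀⟩ := hne
  set z := f₀ c with hz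
  have key : ∀ m ≤ 2 * t, ∃ f ∈ F, f c = z ∧ ∃ x y : ι, ((x = a ∧ y = b) ∨ (x = b ∧ y = a)) ∧
      ∃ w : (kernelGraph q H).Walk (f x) (f₀ a), w.IsPath ∧ w.length = m ∧ z ∉ w.support ∧
        f y ∉ w.support := by
    intro m
    induction m with
    | zero =>
      refine fun _ => ⟨f₀, hf₀, rfl, a, b, Or.inl ⟨rfl, rfl⟩, SimpleGraph.Walk.nil, by simp, by simp,
        ?_, ?_⟩
      · simp [hz, (hinj f₀ hf₀).eq_iff, hac.symm]
      · simp [(hinj f₀ hf₀).eq_iff, hab.symm]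
    | succ m ih =>
      intro hm
      obtain ⟨f, hf, hfz, x, y, hxy, w, hw, hlen, hzw, hyw⟩ := ih (by omega)
      have hyx : (kernelGraph q H).Adj (f y) (f x) := by
        rcases hxy with ⟨rfl, rfl⟩ | ⟨rfl, rfl⟩
        · exact ((h1 f hf).adj hF ((hinj f hf).ne hab)).symm
        · exact (h1 f hf).adj hF ((hinj f hf).ne hab)
      have hker : FunKernel q F {y, c} f := by
        rcases hxy with ⟨rfl, rfl⟩ | ⟨rfl, rfl⟩
        · exact h3 f hf
        · exact h2 f hf
      obtain ⟨g, hg, hgf, hgQ⟩ := hker (w.cons hyx).support.toFinset (by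
        refine (List.toFinset_card_le _).trans ?_
        rw [SimpleGraph.Walk.length_support, SimpleGraph.Walk.length_cons]
        omega)
      have hgy : g y = f y := hgf y (by simp)
      have hxc : x ∉ ({y, c} : Finset ι) := by
        simp only [mem_insert, mem_singleton]
        grind
      refine ⟨g, hg, (hgf c (by simp)).trans hfz, y, x, by tauto, (w.cons hyx).copy hgy.symm rfl,
        ?_, ?_, ?_, ?_⟩
      · rw [SimpleGraph.Walk.isPath_copy]
        exact hw.cons hyw
      · simp [hlen]
      · simp only [SimpleGraph.Walk.support_copy, SimpleGraph.Walk.support_cons, List.mem_cons,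
          not_or]
        refine ⟨?_, hzw⟩
        rw [← hfz]
        exact (hinj f hf).ne (by grind)
      · rw [SimpleGraph.Walk.support_copy]
        have := hgQ x hxc
        rwa [List.mem_toFinset] at this
  obtain ⟨f, hf, hfz, x, y, hxy, w, hw, hlen, hzw, hyw⟩ := key (2 * t) le_rfl
  refine exists_linearCyclic_of_isPath_of_adj ht hH hq w hw hlen hzw ?_ ?_
  · rw [← hfz]
    rcases hxy with ⟨rfl, rfl⟩ | ⟨rfl, rfl⟩
    · exact ((h2 f hf).adj hF ((hinj f hf).ne hac)).symm
    · exact ((h3 f hf).adj hF ((hinj f hf).ne hbc)).symm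
  · exact ((h2 f₀ hf₀).adj hF ((hinj f₀ hf₀).ne hac)).symm

/-- A vertex of `e` forming a kernel pair with all the other vertices of `e`. -/
def IsCentre (q : ℕ) (H : Finset (Finset V)) (e : Finset V) (c : V) : Prop :=
  c ∈ e ∧ ∀ y ∈ e, y ≠ c → (kernelGraph q H).Adj c y

open scoped Classical in
/-- In a hypergraph without linear cycles of length `2 * t + 2` almost all edges have a centre. -/
theorem card_filter_not_isCentre_le (k t q : ℕ) (hk : 5 ≤ k) (ht : 1 ≤ t)
    (hq : k * (2 * t + 2) ≤ q) :
    ∃ C : ℕ, ∀ (V : Type) [Fintype V] [DecidableEq V] (H : Finset (Finset V)),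
      (∀ e ∈ H, e.card = k) →
      (¬ ∃ A : ZMod (2 * t + 2) → Finset V, IsLinearCyclic A ∧ ∀ i, A i ∈ H) →
      (H.filter fun e => ¬ ∃ c, IsCentre q H e c).card ≤ C * Fintype.card V ^ (k - 2) := by
  have hq2 : 2 * t + 2 ≤ q := (Nat.le_mul_of_pos_left _ (by omega)).trans hq
  have hq1 : 2 * Fintype.card (Fin k) ≤ q := by
    rw [Fintype.card_fin]
    refine le_trans ?_ hq
    rw [mul_comm]
    exact Nat.mul_le_mul_left _ (by omega)
  obtain ⟨C, hC⟩ := card_le_or_exists_homogeneous (Fin k) q (k - 2) hq1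
  refine ⟨C, fun V _ _ H hH hno => ?_⟩
  set T := H.filter fun e => ¬ ∃ c, IsCentre q H e c with hT
  have hTk : ∀ e ∈ T, e.card = Fintype.card (Fin k) := fun e he => by
    rw [Fintype.card_fin]
    exact hH e (mem_filter.1 he).1
  refine (card_le_card_enumerations hTk).trans ?_
  rcases hC V (enumerations (Fin k) T) with h | ⟨F, hFT, hne, J, hu, hJ, hr, hker⟩
  · exact h
  exfalso
  have hinj : ∀ g ∈ F, Function.Injective g := fun g hg => (mem_enumerations.1 (hFT hg)).1
  have hFT' : ∀ g ∈ F, univ.image g ∈ T := fun g hg => (mem_enumerations.1 (hFT hg)).2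
  have hF : ∀ g ∈ F, univ.image g ∈ H := fun g hg => (mem_filter.1 (hFT' g hg)).1
  rcases star_or_triangle (by simpa using hk) hu hJ (by simpa using hr) with
    ⟨c, hc⟩ | ⟨a, b, c, hab, hac, hbc, h1, h2, h3⟩
  · obtain ⟨f, hf⟩ := hne
    refine (mem_filter.1 (hFT' f hf)).2 ⟨f c, by simp, fun y hy hyc => ?_⟩
    obtain ⟨i, -, rfl⟩ := mem_image.1 hy
    exact (hker f hf _ (hc i fun h => hyc (by rw [h]))).adj hF hyc.symm
  · exact hno (exists_linearCyclic_of_triangle ht hH hq hq2 hne hF hinj hab hac hbc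
      (fun f hf => hker f hf _ h1) (fun f hf => hker f hf _ h2) fun f hf => hker f hf _ h3)

end Centres

section PathClosing

/-- In a hypergraph without linear cycles of length `2 * t + 2`, there are few sets, indexed by
`δ`, with `t` common neighbours in the kernel graph and one more vertex joined to the positions
in `W`. -/
theorem card_family_le (δ : Type) [Fintype δ] [DecidableEq δ] (k t q r : ℕ) (ht : 1 ≤ t)
    (hq : k * (2 * t + 2) ≤ q) (hq1 : 2 * (Fintype.card δ + (t + 1)) ≤ q)
    (hr : r < Fintype.card δ) :
    ∃ C : ℕ, ∀ (V : Type) [Fintype V] [DecidableEq V] (H : Finset (Finset V)),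
      (∀ e ∈ H, e.card = k) →
      (¬ ∃ A : ZMod (2 * t + 2) → Finset V, IsLinearCyclic A ∧ ∀ i, A i ∈ H) →
      ∀ (F : Finset (δ ⊕ Fin (t + 1) → V)), (∀ f ∈ F, Function.Injective f) →
      (∀ f ∈ F, ∀ g ∈ F, (∀ i, f (Sum.inl i) = g (Sum.inl i)) → f = g) →
      (∀ f ∈ F, ∀ (j : Fin (t + 1)), j.val < t → ∀ i,
        (kernelGraph q H).Adj (f (Sum.inr j)) (f (Sum.inl i))) →
      ∀ U W : Finset δ, U.card = r → (W = univ ∨ ∃ w ∈ U, w ∈ W ∧ ∃ z ∈ U, z ∈ W ∧ w ≠ z) →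
      (U ∩ W).Nonempty →
      (∀ f ∈ F, ∀ i ∈ W, (kernelGraph q H).Adj (f (Sum.inr (Fin.last t))) (f (Sum.inl i))) →
      F.card ≤ C * Fintype.card V ^ (r + 1) := by
  obtain ⟨C, hC⟩ := card_le_or_exists_homogeneous (δ ⊕ Fin (t + 1)) q (r + 1) (by simpa using hq1)
  refine ⟨C, fun V _ _ H hH hno Fam hinj hdet hadj U W hU hW hUW hlast => ?_⟩
  rcases hC V Fam with h | ⟨F, hFsub, ⟨f₀, hf₀⟩, J, hu, -, hcov, hker⟩
  · exact h
  exfalso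
  have hM : ∀ j : Fin (t + 1), ∃ M ∈ J, Sum.inr j ∈ M ∧ (∀ u ∈ U, Sum.inl u ∈ M) ∧
      ∃ y, Sum.inl y ∉ M := by
    intro j
    obtain ⟨M, hM, hsub⟩ := hcov (insert (Sum.inr j) (U.map Function.Embedding.inl)) (by
      rw [card_insert_of_notMem (by simp), card_map, hU])
    refine ⟨M, hM, hsub (by simp), fun u hu => hsub (by simp [hu]), ?_⟩
    by_contra! hall
    obtain ⟨g, hg, h1, h2⟩ := hker f₀ hf₀ M hM (univ.image f₀) (card_image_le.trans (by
      rw [card_univ, Fintype.card_sum, Fintype.card_fin]; omega))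
    have hgf := hdet g (hFsub hg) f₀ (hFsub hf₀) fun i => h1 _ (hall i)
    apply hu
    convert hM
    symm
    rw [eq_univ_iff_forall]
    intro i
    by_contra hi
    exact h2 i hi (by rw [hgf]; simp)
  obtain ⟨z, w, hzU, hzW, hwz⟩ : ∃ z w, z ∈ U ∧ z ∈ W ∧ (W = univ ∨ (w ∈ U ∧ w ∈ W ∧ w ≠ z)) := by
    rcases hW with h | ⟨w, hw, hwW, z, hz, hzW, hne⟩
    · obtain ⟨z, hz⟩ := hUW
      exact ⟨z, z, (mem_inter.1 hz).1, (mem_inter.1 hz).2, Or.inl h⟩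
    · exact ⟨z, w, hz, hzW, Or.inr ⟨hw, hwW, hne⟩⟩
  obtain ⟨y₀, hy₀⟩ : ∃ y, y ∉ U := by
    by_contra! h
    rw [← eq_univ_iff_forall] at h
    rw [← hU, h, card_univ] at hr
    exact lt_irrefl _ hr
  have key : ∀ j (hj : j < t), ∃ f ∈ F, f (Sum.inl z) = f₀ (Sum.inl z) ∧
      ∃ p : (kernelGraph q H).Walk (f (Sum.inr ⟨j, by omega⟩)) (f₀ (Sum.inr 0)),
        p.IsPath ∧ p.length = 2 * j ∧ (∀ u ∈ U, f (Sum.inl u) ∉ p.support) ∧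
        (∀ i : Fin (t + 1), j < i.val → f (Sum.inr i) ∉ p.support) ∧
        ∃ y ∉ U, f (Sum.inl y) ∉ p.support := by
    intro j
    induction j with
    | zero =>
      refine fun hj => ⟨f₀, hf₀, rfl, SimpleGraph.Walk.nil, by simp, by simp, ?_, ?_, y₀, hy₀, ?_⟩
      · intro u hu
        simp [(hinj f₀ (hFsub hf₀)).eq_iff]
      · intro i hi
        simp only [Fin.mk_zero', SimpleGraph.Walk.support_nil, List.mem_cons, List.not_mem_nil,
          or_false, (hinj f₀ (hFsub hf₀)).eq_iff, Sum.inr.injEq]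
        rintro rfl
        simp at hi
      · simp [(hinj f₀ (hFsub hf₀)).eq_iff]
    | succ j ih =>
      intro hj
      obtain ⟨f, hf, hfz, p, hp, hlen, hpU, hpx, y, hyU, hpy⟩ := ih (by omega)
      have hfi := hinj f (hFsub hf)
      have e1 := (hadj f (hFsub hf) ⟨j, by omega⟩ (by simp; omega) y).symm
      have e2 := hadj f (hFsub hf) ⟨j + 1, by omega⟩ (by simpa using hj) y
      have hx' := hpx ⟨j + 1, by omega⟩ (by simp)
      set p' := (p.cons e1).cons e2 with hp'
      have hsupp : ∀ v, v ∈ p'.support ↔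
          v = f (Sum.inr ⟨j + 1, by omega⟩) ∨ v = f (Sum.inl y) ∨ v ∈ p.support := by
        intro v
        simp [hp']
      obtain ⟨M, hMJ, hMx, hMU, y', hMy⟩ := hM ⟨j + 1, by omega⟩
      obtain ⟨g, hg, hgf, hgQ⟩ := hker f hf M hMJ p'.support.toFinset (by
        refine (List.toFinset_card_le _).trans ?_
        rw [SimpleGraph.Walk.length_support, hp', SimpleGraph.Walk.length_cons,
          SimpleGraph.Walk.length_cons]
        omega)
      simp only [List.mem_toFinset] at hgQ
      refine ⟨g, hg, (hgf _ (hMU z hzU)).trans hfz, p'.copy (hgf _ hMx).symm rfl, ?_, ?_, ?_, ?_,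
        y', fun h => hMy (hMU _ h), ?_⟩
      · rw [SimpleGraph.Walk.isPath_copy]
        refine (hp.cons hpy).cons ?_
        rw [SimpleGraph.Walk.support_cons, List.mem_cons, not_or]
        exact ⟨hfi.ne (by simp), hx'⟩
      · simp [hp', hlen]
        ring
      · intro u hu
        rw [SimpleGraph.Walk.support_copy, hgf _ (hMU u hu), hsupp]
        push Not
        refine ⟨hfi.ne (by simp), hfi.ne ?_, hpU u hu⟩
        rw [Ne, Sum.inl.injEq]
        rintro rfl
        exact hyU hu
      · intro i hi
        rw [SimpleGraph.Walk.support_copy]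
        by_cases hiM : Sum.inr i ∈ M
        · rw [hgf _ hiM, hsupp]
          push Not
          refine ⟨hfi.ne ?_, hfi.ne (by simp), hpx i (by omega)⟩
          rw [Ne, Sum.inr.injEq]
          rintro rfl
          simp at hi
        · exact hgQ _ hiM
      · rw [SimpleGraph.Walk.support_copy]
        exact hgQ _ hMy
  obtain ⟨f, hf, hfz, p, hp, hlen, hpU, hpx, y, hyU, hpy⟩ := key (t - 1) (by omega)
  have hfi := hinj f (hFsub hf)
  obtain ⟨v, hvz, hvW, hvp⟩ : ∃ v, v ≠ z ∧ v ∈ W ∧ f (Sum.inl v) ∉ p.support := by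
    rcases hwz with rfl | ⟨hwU, hwW, hwz⟩
    · exact ⟨y, fun h => hyU (h ▸ hzU), mem_univ _, hpy⟩
    · exact ⟨w, hwz, hwW, hpU w hwU⟩
  have e1 := (hadj f (hFsub hf) ⟨t - 1, by omega⟩ (by simp; omega) v).symm
  have e2 := hlast f (hFsub hf) v hvW
  refine hno (exists_linearCyclic_of_isPath_of_adj ht hH hq ((p.cons e1).cons e2)
    (z := f (Sum.inl z)) ?_ ?_ ?_ ?_ ?_)
  · refine (hp.cons hvp).cons ?_
    rw [SimpleGraph.Walk.support_cons, List.mem_cons, not_or]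
    exact ⟨hfi.ne (by simp), hpx _ (by simp; omega)⟩
  · simp only [SimpleGraph.Walk.length_cons, hlen]
    omega
  · simp only [SimpleGraph.Walk.support_cons, List.mem_cons, not_or]
    refine ⟨hfi.ne (by simp), hfi.ne ?_, hpU z hzU⟩
    rw [Ne, Sum.inl.injEq]
    exact hvz.symm
  · exact (hlast f (hFsub hf) z hzW).symm
  · rw [hfz]
    exact (hadj f₀ (hFsub hf₀) 0 (by rw [Fin.val_zero]; omega) z).symm

end PathClosing

section PerfectSets

variable {V : Type} [Fintype V] [DecidableEq V]

open scoped Classical in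
/-- The vertices outside `D` that are centres of an edge extending `D`. -/
noncomputable def centres (q : ℕ) (H : Finset (Finset V)) (D : Finset V) : Finset V :=
  univ.filter fun x => x ∉ D ∧ insert x D ∈ H ∧ ∀ y ∈ D, (kernelGraph q H).Adj x y

lemma mem_centres {q : ℕ} {H : Finset (Finset V)} {D : Finset V} {x : V} :
    x ∈ centres q H D ↔ x ∉ D ∧ insert x D ∈ H ∧ ∀ y ∈ D, (kernelGraph q H).Adj x y := by
  simp [centres]

omit [Fintype V] [DecidableEq V] in
lemma injective_vec_pair {y z : V} (h : y ≠ z) : Function.Injective ![y, z] := by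
  intro i j hij
  fin_cases i <;> fin_cases j <;> simp_all

omit [Fintype V] in
lemma exists_family {α β : Type} [Fintype α] [Fintype β] [DecidableEq α] [DecidableEq β]
    {T : Finset (Finset V)} {P : (α ⊕ β → V) → Prop}
    (h : ∀ D ∈ T, ∃ f : α ⊕ β → V, (univ.image fun i => f (Sum.inl i)) = D ∧ P f) :
    ∃ F : Finset (α ⊕ β → V), T.card = F.card ∧
      (∀ f ∈ F, ∀ g ∈ F, (∀ i, f (Sum.inl i) = g (Sum.inl i)) → f = g) ∧ ∀ f ∈ F, P f := by
  choose φ h1 h2 using h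
  refine ⟨T.attach.image fun D => φ D.1 D.2, ?_, ?_, ?_⟩
  · rw [card_image_of_injective, card_attach]
    intro D D' hDD
    apply Subtype.ext
    rw [← h1 D.1 D.2, ← h1 D'.1 D'.2]
    simp only at hDD
    rw [hDD]
  · intro f hf g hg hfg
    obtain ⟨D, -, rfl⟩ := mem_image.1 hf
    obtain ⟨D', -, rfl⟩ := mem_image.1 hg
    have : D = D' := by
      apply Subtype.ext
      rw [← h1 D.1 D.2, ← h1 D'.1 D'.2]
      simp only [hfg]
    rw [this]
  · intro f hf
    obtain ⟨D, -, rfl⟩ := mem_image.1 hf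
    exact h2 D.1 D.2

open scoped Classical in
/-- Few `(k - 1)`-sets have more than `t` centres. -/
theorem card_filter_lt_centres_le (k t q : ℕ) (hk : 5 ≤ k) (ht : 1 ≤ t)
    (hq : k * (2 * t + 2) ≤ q) (hq1 : 2 * (k + t) ≤ q) :
    ∃ C : ℕ, ∀ (V : Type) [Fintype V] [DecidableEq V] (H : Finset (Finset V)),
      (∀ e ∈ H, e.card = k) →
      (¬ ∃ A : ZMod (2 * t + 2) → Finset V, IsLinearCyclic A ∧ ∀ i, A i ∈ H) →
      ((powersetCard (k - 1) (univ : Finset V)).filter fun D => t < (centres q H D).card).card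
        ≤ C * Fintype.card V ^ 2 := by
  have : NeZero (k - 1) := ⟨by omega⟩
  obtain ⟨C, hC⟩ := card_family_le (Fin (k - 1)) k t q 1 ht hq (by rw [Fintype.card_fin]; omega)
    (by rw [Fintype.card_fin]; omega)
  refine ⟨C, fun V _ _ H hH hno => ?_⟩
  obtain ⟨F, hTF, hdet, hF⟩ := exists_family (α := Fin (k - 1)) (β := Fin (t + 1))
    (T := (powersetCard (k - 1) (univ : Finset V)).filter fun D => t < (centres q H D).card)
    (P := fun f => Function.Injective f ∧
      ∀ j i, (kernelGraph q H).Adj (f (Sum.inr j)) (f (Sum.inl i))) (by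
    intro D hD
    rw [mem_filter, mem_powersetCard] at hD
    obtain ⟨S, hS, hSt⟩ := exists_subset_card_eq (Nat.succ_le_of_lt hD.2)
    obtain ⟨e, he, rfl⟩ := exists_enumeration (ι := Fin (k - 1)) (e := D) (by simp [hD.1.2])
    obtain ⟨s, hs, rfl⟩ := exists_enumeration (ι := Fin (t + 1)) (e := S) (by simp [hSt])
    have hs' : ∀ j, s j ∈ centres q H (univ.image e) := fun j => hS (by simp)
    simp only [mem_centres] at hs'
    refine ⟨Sum.elim e s, by simp, ?_, ?_⟩
    · refine he.sumElim hs fun i j h => (hs' j).1 ?_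
      rw [← h]
      simp
    · intro j i
      exact (hs' j).2.2 _ (by simp))
  rw [hTF]
  exact hC V H hH hno F (fun f hf => (hF f hf).1) hdet (fun f hf j _ i => (hF f hf).2 j i)
    {0} univ (by simp) (Or.inl rfl) (by simp) fun f hf i _ => (hF f hf).2 _ i

open scoped Classical in
/-- Few `(k - 1)`-sets with at least `t` centres have two neighbours of a vertex which is not a
centre. -/
theorem card_filter_extra_le (k t q : ℕ) (hk : 5 ≤ k) (ht : 1 ≤ t)
    (hq : k * (2 * t + 2) ≤ q) (hq1 : 2 * (k + t) ≤ q) :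
    ∃ C : ℕ, ∀ (V : Type) [Fintype V] [DecidableEq V] (H : Finset (Finset V)),
      (∀ e ∈ H, e.card = k) →
      (¬ ∃ A : ZMod (2 * t + 2) → Finset V, IsLinearCyclic A ∧ ∀ i, A i ∈ H) →
      ((powersetCard (k - 1) (univ : Finset V)).filter fun D => t ≤ (centres q H D).card ∧
        ∃ x, x ∉ D ∧ x ∉ centres q H D ∧ ∃ y ∈ D, ∃ z ∈ D, y ≠ z ∧
          (kernelGraph q H).Adj x y ∧ (kernelGraph q H).Adj x z).card
        ≤ C * Fintype.card V ^ 3 := by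
  obtain ⟨C, hC⟩ := card_family_le (Fin 2 ⊕ Fin (k - 3)) k t q 2 ht hq
    (by rw [Fintype.card_sum, Fintype.card_fin, Fintype.card_fin]; omega)
    (by rw [Fintype.card_sum, Fintype.card_fin, Fintype.card_fin]; omega)
  refine ⟨C, fun V _ _ H hH hno => ?_⟩
  obtain ⟨F, hTF, hdet, hF⟩ := exists_family (α := Fin 2 ⊕ Fin (k - 3)) (β := Fin (t + 1))
    (T := (powersetCard (k - 1) (univ : Finset V)).filter fun D => t ≤ (centres q H D).card ∧
        ∃ x, x ∉ D ∧ x ∉ centres q H D ∧ ∃ y ∈ D, ∃ z ∈ D, y ≠ z ∧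
          (kernelGraph q H).Adj x y ∧ (kernelGraph q H).Adj x z)
    (P := fun f => Function.Injective f ∧
      (∀ j : Fin (t + 1), j.val < t → ∀ i,
        (kernelGraph q H).Adj (f (Sum.inr j)) (f (Sum.inl i))) ∧
      ∀ i : Fin 2, (kernelGraph q H).Adj (f (Sum.inr (Fin.last t))) (f (Sum.inl (Sum.inl i)))) (by
    intro D hD
    rw [mem_filter, mem_powersetCard] at hD
    obtain ⟨⟨-, hDk⟩, hDt, x, hxD, hxc, y, hy, z, hz, hyz, hxy, hxz⟩ := hD
    obtain ⟨S, hS, hSt⟩ := exists_subset_card_eq hDt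
    obtain ⟨e, he, heD⟩ := exists_enumeration (ι := Fin (k - 3)) (e := D \ {y, z}) (by
      rw [card_sdiff_of_subset (by simp [insert_subset_iff, hy, hz]), card_pair hyz,
        Fintype.card_fin, hDk]
      omega)
    have heD' : ∀ i, e i ∈ D \ {y, z} := fun i => by rw [← heD]; simp
    simp only [mem_sdiff, mem_insert, mem_singleton, not_or] at heD'
    obtain ⟨s, hs, rfl⟩ := exists_enumeration (ι := Fin t) (e := S) (by simp [hSt])
    have hs' : ∀ j, s j ∈ centres q H D := fun j => hS (by simp)
    have hsx : ∀ j, s j ≠ x := fun j h => hxc (h ▸ hs' j)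
    simp only [mem_centres] at hs'
    have hmem : ∀ i, Sum.elim ![y, z] e i ∈ D := by
      rintro (i | i)
      · fin_cases i
        · exact hy
        · exact hz
      · exact (heD' i).1
    refine ⟨Sum.elim (Sum.elim ![y, z] e) (Fin.snoc (α := fun _ => V) s x), ?_, ?_, ?_, ?_⟩
    · ext v
      simp only [Sum.elim_inl, mem_image, mem_univ, true_and]
      constructor
      · rintro ⟨i, rfl⟩
        exact hmem i
      · intro hv
        by_cases hvy : v = y
        · exact ⟨Sum.inl 0, by simp [hvy]⟩
        by_cases hvz : v = z
        · exact ⟨Sum.inl 1, by simp [hvz]⟩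
        have : v ∈ univ.image e := by
          rw [heD]
          simp [hv, hvy, hvz]
        obtain ⟨i, -, rfl⟩ := mem_image.1 this
        exact ⟨Sum.inr i, rfl⟩
    · refine Function.Injective.sumElim (Function.Injective.sumElim ?_ he ?_) ?_ ?_
      · exact injective_vec_pair hyz
      · intro i j
        fin_cases i
        · exact fun h => (heD' j).2.1 h.symm
        · exact fun h => (heD' j).2.2 h.symm
      · rw [Fin.snoc_injective_iff]
        exact ⟨hs, fun ⟨j, hj⟩ => hsx j hj⟩
      · intro i j h
        have := hmem i
        rw [h] at this
        induction j using Fin.lastCases with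
        | last => exact hxD (by simpa using this)
        | cast j => exact (hs' j).1 (by simpa using this)
    · intro j hj i
      induction j using Fin.lastCases with
      | last => simp at hj
      | cast j =>
        have := (hs' j).2.2 _ (hmem i)
        simpa using this
    · intro i
      fin_cases i
      · simpa using hxy
      · simpa using hxz)
  rw [hTF]
  exact hC V H hH hno F (fun f hf => (hF f hf).1) hdet (fun f hf => (hF f hf).2.1)
    {Sum.inl 0, Sum.inl 1} {Sum.inl 0, Sum.inl 1} (card_pair (by simp))
    (Or.inr ⟨Sum.inl 0, by simp, by simp, Sum.inl 1, by simp, by simp, by simp⟩) (by simp)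
    fun f hf i hi => by
      simp only [mem_insert, mem_singleton] at hi
      rcases hi with rfl | rfl
      · exact (hF f hf).2.2 0
      · exact (hF f hf).2.2 1

end PerfectSets

section Binomials

lemma choose_succ_le_add (n t j : ℕ) : n.choose (j + 1) ≤ (n - t).choose (j + 1) + t * n ^ j := by
  induction t with
  | zero => simp
  | succ t ih =>
    rcases Nat.lt_or_ge t n with h | h
    · have e : n - t = (n - (t + 1)) + 1 := by omega
      rw [e, Nat.choose_succ_succ, Nat.succ_eq_add_one] at ih
      have h1 : (n - (t + 1)).choose j ≤ n ^ j :=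
        (Nat.choose_le_pow _ _).trans (Nat.pow_le_pow_left (by omega) _)
      rw [add_mul, one_mul]
      omega
    · rw [show n - (t + 1) = n - t by omega]
      refine ih.trans (Nat.add_le_add_left (Nat.mul_le_mul_right _ (by omega)) _)

lemma choose_add_mul_choose_le {n t : ℕ} (h : t ≤ n) (j : ℕ) :
    (n - t).choose (j + 1) + t * (n - t).choose j ≤ n.choose (j + 1) := by
  induction t with
  | zero => simp
  | succ t ih =>
    have ih := ih (by omega)
    have e : n - t = (n - (t + 1)) + 1 := by omega
    have h1 : (n - (t + 1)).choose j ≤ (n - t).choose j := Nat.choose_le_choose _ (by omega)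
    have h2 : t * (n - (t + 1)).choose j ≤ t * (n - t).choose j := Nat.mul_le_mul_left _ h1
    have h3 : (n - t).choose (j + 1) = (n - (t + 1)).choose j + (n - (t + 1)).choose (j + 1) := by
      rw [e, Nat.choose_succ_succ]
    rw [add_mul, one_mul]
    omega

lemma exists_pow_le_mul_choose (a r : ℕ) :
    ∃ c : ℕ, ∀ n ≥ 2 * (a + r), n ^ r ≤ c * (n - a).choose r := by
  refine ⟨2 ^ r * r.factorial, fun n hn => ?_⟩
  have h := Nat.pow_sub_le_descFactorial (n - a) r
  rw [Nat.descFactorial_eq_factorial_mul_choose] at h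
  calc n ^ r ≤ (2 * (n - a + 1 - r)) ^ r := Nat.pow_le_pow_left (by omega) _
    _ = 2 ^ r * (n - a + 1 - r) ^ r := mul_pow _ _ _
    _ ≤ 2 ^ r * (r.factorial * (n - a).choose r) := Nat.mul_le_mul_left _ h
    _ = _ := by ring

/-- A polynomial of smaller degree is eventually smaller than a binomial coefficient. -/
lemma exists_mul_pow_lt_choose (C a r : ℕ) :
    ∃ n₀, ∀ n ≥ n₀, C * n ^ r < (n - a).choose (r + 1) := by
  obtain ⟨c, hc⟩ := exists_pow_le_mul_choose a (r + 1)
  refine ⟨2 * (a + (r + 1)) + c * C + 1, fun n hn => ?_⟩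
  have h := hc n (by omega)
  by_contra! hcon
  have h1 : n * n ^ r ≤ (c * C) * n ^ r :=
    calc n * n ^ r = n ^ (r + 1) := by ring
      _ ≤ c * (C * n ^ r) := h.trans (Nat.mul_le_mul_left _ hcon)
      _ = (c * C) * n ^ r := by ring
  have h2 := Nat.le_of_mul_le_mul_right h1 (by have : 0 < n := by omega
                                               positivity)
  omega

end Binomials

section Counting

variable {V : Type} [Fintype V] [DecidableEq V]

/-- The number of `j`-sets between `A` and the complement of `B`. -/
lemma card_filter_subset_disjoint {A B : Finset V} {j : ℕ} (hAB : Disjoint A B) (hA : A.card ≤ j) :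
    ((powersetCard j (univ : Finset V)).filter fun D => A ⊆ D ∧ Disjoint D B).card =
      (Fintype.card V - A.card - B.card).choose (j - A.card) := by
  have hc : (univ \ (A ∪ B)).card = Fintype.card V - A.card - B.card := by
    rw [card_sdiff_of_subset (subset_univ _), card_union_of_disjoint hAB, card_univ, Nat.sub_sub]
  rw [← hc, ← card_powersetCard]
  symm
  refine card_bij' (fun E _ => E ∪ A) (fun D _ => D \ A) ?_ ?_ ?_ ?_
  · intro E hE
    rw [mem_powersetCard] at hE
    have h1 : Disjoint E A := disjoint_left.2 fun v hv hvA => by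
      have := hE.1 hv
      simp [hvA] at this
    have h2 : Disjoint E B := disjoint_left.2 fun v hv hvA => by
      have := hE.1 hv
      simp [hvA] at this
    rw [mem_filter, mem_powersetCard]
    refine ⟨⟨subset_univ _, ?_⟩, subset_union_right, ?_⟩
    · rw [card_union_of_disjoint h1]
      omega
    · rw [disjoint_union_left]
      exact ⟨h2, hAB⟩
  · intro D hD
    rw [mem_filter, mem_powersetCard] at hD
    rw [mem_powersetCard, card_sdiff_of_subset hD.2.1, hD.1.2]
    refine ⟨fun v hv => ?_, rfl⟩
    rw [mem_sdiff] at hv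
    simp only [mem_sdiff, mem_univ, mem_union, true_and, not_or]
    exact ⟨hv.2, disjoint_left.1 hD.2.2 hv.1⟩
  · intro E hE
    rw [mem_powersetCard] at hE
    have h1 : Disjoint E A := disjoint_left.2 fun v hv hvA => by
      have := hE.1 hv
      simp [hvA] at this
    rw [union_sdiff_right, sdiff_eq_self_of_disjoint h1]
  · intro D hD
    rw [mem_filter] at hD
    exact sdiff_union_of_subset hD.2.1

lemma card_filter_subset_le {A : Finset V} {j : ℕ} (hA : A.card ≤ j) :
    ((powersetCard j (univ : Finset V)).filter fun D => A ⊆ D).card ≤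
      Fintype.card V ^ (j - A.card) := by
  have h := card_filter_subset_disjoint (A := A) (B := ∅) (j := j) (by simp) hA
  simp only [disjoint_empty_right, and_true, card_empty, Nat.sub_zero] at h
  rw [h]
  exact (Nat.choose_le_pow _ _).trans (Nat.pow_le_pow_left (by omega) _)

lemma card_filter_pair_le {A B : Finset V} {k : ℕ} (hk : 2 ≤ k) :
    ((powersetCard k (univ : Finset V)).filter fun e =>
      ∃ x ∈ A, ∃ u ∈ B, x ≠ u ∧ x ∈ e ∧ u ∈ e).card ≤
      A.card * B.card * Fintype.card V ^ (k - 2) := by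
  calc _ ≤ (((A ×ˢ B).filter fun p => p.1 ≠ p.2).biUnion fun p =>
        (powersetCard k (univ : Finset V)).filter fun D => {p.1, p.2} ⊆ D).card := by
        refine card_le_card fun e he => ?_
        rw [mem_filter] at he
        obtain ⟨hek, x, hx, u, hu, hxu, hxe, hue⟩ := he
        simp only [mem_biUnion, mem_filter, mem_product]
        exact ⟨(x, u), ⟨⟨hx, hu⟩, hxu⟩, hek, by simp [insert_subset_iff, hxe, hue]⟩
    _ ≤ ((A ×ˢ B).filter fun p => p.1 ≠ p.2).card * Fintype.card V ^ (k - 2) := by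
        refine card_biUnion_le_card_mul _ _ _ fun p hp => ?_
        have := card_pair (mem_filter.1 hp).2
        have h := card_filter_subset_le (A := {p.1, p.2}) (j := k) (by omega)
        rwa [this] at h
    _ ≤ _ := by
        refine Nat.mul_le_mul_right _ ((card_filter_le _ _).trans ?_)
        rw [card_product]

/-- A family of `j`-sets of size `O(n ^ (j - 1))` has few members above some `i`-set. -/
theorem exists_card_filter_subset_le (C i j : ℕ) (hij : i < j) :
    ∃ C' n₀ : ℕ, ∀ (V : Type) [Fintype V] [DecidableEq V], n₀ ≤ Fintype.card V →
      ∀ B : Finset (Finset V), (∀ D ∈ B, D.card = j) → B.card ≤ C * Fintype.card V ^ (j - 1) →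
      ∃ Z : Finset V, Z.card = i ∧
        (B.filter fun D => Z ⊆ D).card ≤ C' * Fintype.card V ^ (j - 1 - i) := by
  obtain ⟨c, hc⟩ := exists_pow_le_mul_choose 0 i
  refine ⟨C * 2 ^ j * c, 2 * (0 + i), fun V _ _ hn B hB hcard => ?_⟩
  by_contra! hcon
  set n := Fintype.card V with hnV
  have h := card_mul_le_card_mul (s := powersetCard i (univ : Finset V)) (t := B)
    (fun Z D => Z ⊆ D) (m := C * 2 ^ j * c * n ^ (j - 1 - i) + 1) (n := 2 ^ j)
    (fun Z hZ => hcon Z (mem_powersetCard.1 hZ).2)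
    (fun D hD => by
      calc _ ≤ (D.powerset).card := card_le_card fun Z hZ => by
            rw [mem_bipartiteBelow] at hZ
            exact mem_powerset.2 hZ.2
        _ = 2 ^ j := by rw [card_powerset, hB D hD])
  rw [card_powersetCard, card_univ, ← hnV] at h
  have h1 := hc n hn
  rw [Nat.sub_zero] at h1
  have h2 : n.choose i * (C * 2 ^ j * c * n ^ (j - 1 - i) + 1) ≤
      n.choose i * (C * 2 ^ j * c * n ^ (j - 1 - i)) :=
    calc _ ≤ B.card * 2 ^ j := h
      _ ≤ C * n ^ (j - 1) * 2 ^ j := Nat.mul_le_mul_right _ hcard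
      _ = C * 2 ^ j * n ^ (j - 1 - i) * n ^ i := by
        rw [mul_assoc _ (n ^ (j - 1 - i)), ← pow_add, show j - 1 - i + i = j - 1 by omega]
        ring
      _ ≤ C * 2 ^ j * n ^ (j - 1 - i) * (c * n.choose i) := Nat.mul_le_mul_left _ h1
      _ = _ := by ring
  have h3 : 0 < n.choose i := Nat.choose_pos (by omega)
  have := Nat.le_of_mul_le_mul_left h2 h3
  omega

end Counting

section StructureOfEdges

/-- A set `D` is perfect if it has exactly `t` centres and every other outer vertex has at most
one neighbour in `D`. -/
def IsPerfect {V : Type} [Fintype V] [DecidableEq V] (q t : ℕ) (H : Finset (Finset V))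
    (D : Finset V) : Prop :=
  (centres q H D).card = t ∧ ∀ x, x ∉ D → x ∉ centres q H D → ∀ y ∈ D, ∀ z ∈ D, y ≠ z →
    (kernelGraph q H).Adj x y → ¬ (kernelGraph q H).Adj x z

open scoped Classical in
lemma card_filter_isCentre_add_le {V : Type} [Fintype V] [DecidableEq V] {k t q : ℕ}
    {H : Finset (Finset V)} (hH : ∀ e ∈ H, e.card = k) :
    (H.filter fun e => ∃ c, IsCentre q H e c).card +
      ((powersetCard (k - 1) (univ : Finset V)).filter fun D => (centres q H D).card < t).card ≤
    (Fintype.card V).choose (k - 1) * t +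
      ((powersetCard (k - 1) (univ : Finset V)).filter fun D => t < (centres q H D).card).card *
        Fintype.card V := by
  set P := powersetCard (k - 1) (univ : Finset V) with hP
  have h1 : (H.filter fun e => ∃ c, IsCentre q H e c).card ≤ ∑ D ∈ P, (centres q H D).card := by
    calc _ ≤ (P.biUnion fun D => (centres q H D).image fun x => insert x D).card := by
          refine card_le_card fun e he => ?_
          obtain ⟨heH, c, hce, hc⟩ := mem_filter.1 he
          simp only [mem_biUnion, mem_image]
          refine ⟨e.erase c, ?_, c, mem_centres.2 ⟨notMem_erase c e, ?_, ?_⟩, insert_erase hce⟩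
          · rw [hP, mem_powersetCard, card_erase_of_mem hce, hH e heH]
            exact ⟨subset_univ _, rfl⟩
          · rwa [insert_erase hce]
          · intro y hy
            exact hc y (mem_of_mem_erase hy) (ne_of_mem_erase hy)
      _ ≤ ∑ D ∈ P, ((centres q H D).image fun x => insert x D).card := card_biUnion_le
      _ ≤ _ := sum_le_sum fun D _ => card_image_le
  refine (Nat.add_le_add_right h1 _).trans ?_
  rw [card_filter, card_filter, sum_mul, ← sum_add_distrib]
  have hPc : P.card = (Fintype.card V).choose (k - 1) := by rw [hP, card_powersetCard, card_univ]
  rw [← hPc, ← smul_eq_mul P.card, ← sum_const, ← sum_add_distrib]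
  refine sum_le_sum fun D _ => ?_
  have : (centres q H D).card ≤ Fintype.card V := card_le_univ _
  split_ifs <;> omega

open scoped Classical in
/-- In a large hypergraph without linear cycles of length `2 * t + 2`, almost all `(k - 1)`-sets
are perfect. -/
theorem card_filter_not_isPerfect_le (k t q : ℕ) (hk : 5 ≤ k) (ht : 1 ≤ t)
    (hq : k * (2 * t + 2) ≤ q) (hq1 : 2 * (k + t) ≤ q) :
    ∃ C : ℕ, ∀ (V : Type) [Fintype V] [DecidableEq V] (H : Finset (Finset V)),
      1 ≤ Fintype.card V → (∀ e ∈ H, e.card = k) →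
      (¬ ∃ A : ZMod (2 * t + 2) → Finset V, IsLinearCyclic A ∧ ∀ i, A i ∈ H) →
      t * (Fintype.card V - t).choose (k - 1) ≤ H.card →
      ((powersetCard (k - 1) (univ : Finset V)).filter fun D => ¬ IsPerfect q t H D).card ≤
        C * Fintype.card V ^ (k - 2) := by
  obtain ⟨C₁, h₁⟩ := card_filter_not_isCentre_le k t q hk ht hq
  obtain ⟨C₂, h₂⟩ := card_filter_lt_centres_le k t q hk ht hq hq1
  obtain ⟨C₃, h₃⟩ := card_filter_extra_le k t q hk ht hq hq1
  refine ⟨C₁ + 2 * C₂ + C₃ + t * t, fun V _ _ H hn hH hno hcard => ?_⟩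
  have h₁ := h₁ V H hH hno
  have h₂ := h₂ V H hH hno
  have h₃ := h₃ V H hH hno
  have h₄ := card_filter_isCentre_add_le (q := q) (t := t) hH
  have h₅ := card_filter_add_card_filter_not (s := H) fun e => ∃ c, IsCentre q H e c
  set n := Fintype.card V with hnV
  set P := powersetCard (k - 1) (univ : Finset V) with hP
  set X := (P.filter fun D => t < (centres q H D).card) with hX
  set Y := (P.filter fun D => t ≤ (centres q H D).card ∧
        ∃ x, x ∉ D ∧ x ∉ centres q H D ∧ ∃ y ∈ D, ∃ z ∈ D, y ≠ z ∧
          (kernelGraph q H).Adj x y ∧ (kernelGraph q H).Adj x z) with hY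
  set L := (P.filter fun D => (centres q H D).card < t) with hL
  have hcov : (P.filter fun D => ¬ IsPerfect q t H D) ⊆ L ∪ X ∪ Y := by
    intro D hD
    rw [mem_filter] at hD
    rcases lt_trichotomy (centres q H D).card t with h | h | h
    · exact mem_union_left _ (mem_union_left _ (mem_filter.2 ⟨hD.1, h⟩))
    · refine mem_union_right _ (mem_filter.2 ⟨hD.1, h.ge, ?_⟩)
      have := hD.2
      unfold IsPerfect at this
      push Not at this
      exact this h
    · exact mem_union_left _ (mem_union_right _ (mem_filter.2 ⟨hD.1, h⟩))
  have hcov' := card_le_card hcov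
  have hu1 := card_union_le (L ∪ X) Y
  have hu2 := card_union_le L X
  have hX' : X.card ≤ C₂ * n ^ (k - 2) :=
    h₂.trans (Nat.mul_le_mul_left _ (Nat.pow_le_pow_right hn (by omega)))
  have hXn : X.card * n ≤ C₂ * n ^ (k - 2) :=
    calc X.card * n ≤ C₂ * n ^ 2 * n := Nat.mul_le_mul_right _ h₂
      _ = C₂ * n ^ 3 := by ring
      _ ≤ _ := Nat.mul_le_mul_left _ (Nat.pow_le_pow_right hn (by omega))
  have hY' : Y.card ≤ C₃ * n ^ (k - 2) :=
    h₃.trans (Nat.mul_le_mul_left _ (Nat.pow_le_pow_right hn (by omega)))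
  have hb : t * n.choose (k - 1) ≤ t * (n - t).choose (k - 1) + t * t * n ^ (k - 2) := by
    have := Nat.mul_le_mul_left t (choose_succ_le_add n t (k - 2))
    rw [show k - 2 + 1 = k - 1 by omega] at this
    linarith
  nlinarith

open scoped Classical in
/-- A large hypergraph without linear cycles of length `2 * t + 2` contains almost all edges
meeting some `t`-set. -/
theorem exists_card_missing_le (k t q : ℕ) (hk : 5 ≤ k) (ht : 1 ≤ t)
    (hq : k * (2 * t + 2) ≤ q) (hq1 : 2 * (k + t) ≤ q) :
    ∃ C n₀ : ℕ, ∀ (V : Type) [Fintype V] [DecidableEq V] (H : Finset (Finset V)),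
      n₀ ≤ Fintype.card V → (∀ e ∈ H, e.card = k) →
      (¬ ∃ A : ZMod (2 * t + 2) → Finset V, IsLinearCyclic A ∧ ∀ i, A i ∈ H) →
      t * (Fintype.card V - t).choose (k - 1) ≤ H.card →
      ∃ S : Finset V, S.card = t ∧
        ((powersetCard k (univ : Finset V)).filter fun e => ¬ Disjoint e S ∧ e ∉ H).card ≤
          C * Fintype.card V ^ (k - 2) := by
  obtain ⟨C₁, h₁⟩ := card_filter_not_isPerfect_le k t q hk ht hq hq1
  obtain ⟨C₂, n₂, h₂⟩ := exists_card_filter_subset_le C₁ 2 (k - 1) (by omega)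
  obtain ⟨n₃, h₃⟩ := exists_mul_pow_lt_choose C₂ 2 (k - 4)
  obtain ⟨c, hc⟩ := exists_pow_le_mul_choose (3 + t) (k - 4)
  refine ⟨t * C₁ + t * (t + (k - 1) * (C₂ * c)), n₂ + n₃ + 2 * (3 + t + (k - 4)) + 1,
    fun V _ _ H hn hH hno hcard => ?_⟩
  set n := Fintype.card V with hnV
  set P := powersetCard (k - 1) (univ : Finset V) with hP
  have hB := h₁ V H (by omega) hH hno hcard
  set B := P.filter fun D => ¬ IsPerfect q t H D with hBdef
  have hBk : ∀ D ∈ B, D.card = k - 1 := fun D hD => (mem_powersetCard.1 (mem_filter.1 hD).1).2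
  obtain ⟨Z, hZ2, hZ⟩ := h₂ V (by omega) B hBk (by rwa [show k - 1 - 1 = k - 2 by omega])
  rw [show k - 1 - 1 - 2 = k - 4 by omega, ← hnV] at hZ
  obtain ⟨D₁, hD₁k, hZD₁, hD₁⟩ : ∃ D₁, D₁.card = k - 1 ∧ Z ⊆ D₁ ∧ IsPerfect q t H D₁ := by
    by_contra! hcon
    have hfull := card_filter_subset_disjoint (A := Z) (B := ∅) (j := k - 1) (by simp)
      (by rw [hZ2]; omega)
    rw [hZ2, card_empty, Nat.sub_zero, ← hnV] at hfull
    have h := h₃ n (by omega)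
    rw [show k - 4 + 1 = k - 1 - 2 by omega, ← hfull] at h
    refine absurd (h.trans_le (card_le_card ?_)) hZ.not_gt
    intro D hD
    rw [mem_filter, mem_powersetCard] at hD
    rw [mem_filter, hBdef, mem_filter, hP, mem_powersetCard]
    exact ⟨⟨hD.1, hcon D hD.1.2 hD.2.1⟩, hD.2.1⟩
  set S := centres q H D₁ with hS
  obtain ⟨z, w, hzw, rfl⟩ := card_eq_two.1 hZ2
  have hzD := hZD₁ (mem_insert_self z {w})
  have hwD := hZD₁ (mem_insert_of_mem (mem_singleton_self w) : w ∈ ({z, w} : Finset V))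
  have hSz : ∀ x ∈ S, (kernelGraph q H).Adj x z := fun x hx => (mem_centres.1 hx).2.2 z hzD
  have hSw : ∀ x ∈ S, (kernelGraph q H).Adj x w := fun x hx => (mem_centres.1 hx).2.2 w hwD
  have hcentre : ∀ D, D.card = k - 1 → D ∉ B → Disjoint D S → ∀ x ∈ S,
      (∃ y ∈ D, ∃ y' ∈ D, y ≠ y' ∧ (kernelGraph q H).Adj x y ∧ (kernelGraph q H).Adj x y') →
      x ∈ centres q H D := by
    rintro D hDk hDB hDS x hx ⟨y, hy, y', hy', hne, h1, h2⟩
    have hper : IsPerfect q t H D := by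
      by_contra h
      exact hDB (mem_filter.2 ⟨mem_powersetCard.2 ⟨subset_univ _, hDk⟩, h⟩)
    by_contra hxc
    exact hper.2 x (fun h => disjoint_left.1 hDS h hx) hxc y hy y' hy' hne h1 h2
  set Y := univ.filter fun y => y ∉ ({z, w} : Finset V) ∧ y ∉ S ∧
    ∃ x ∈ S, ¬ (kernelGraph q H).Adj x y with hY
  have hYB : ∀ y ∈ Y, ∀ D, D.card = k - 1 → {z, w, y} ⊆ D → Disjoint D S → D ∈ B := by
    intro y hy D hDk hsub hDS
    obtain ⟨-, -, x, hx, hxy⟩ := (mem_filter.1 hy).2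
    by_contra hDB
    simp only [insert_subset_iff, singleton_subset_iff] at hsub
    have := hcentre D hDk hDB hDS x hx
      ⟨z, hsub.1, w, hsub.2.1, hzw, hSz x hx, hSw x hx⟩
    exact hxy ((mem_centres.1 this).2.2 y hsub.2.2)
  have hzwS : Disjoint {z, w} S := by
    rw [disjoint_left]
    intro v hv hvS
    exact (mem_centres.1 hvS).1 (hZD₁ hv)
  have hYcard : Y.card ≤ (k - 1) * (C₂ * c) := by
    have h := card_mul_le_card_mul (s := Y) (t := B.filter fun D => {z, w} ⊆ D)
      (fun y D => y ∈ D) (m := (n - (3 + t)).choose (k - 4)) (n := k - 1)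
      (fun y hy => by
        have hy' := (mem_filter.1 hy).2
        have h3 : ({z, w, y} : Finset V).card = 3 := card_eq_three.2 ⟨z, w, y, hzw, by
          have := hy'.1
          simp only [mem_insert, mem_singleton, not_or] at this
          exact ⟨Ne.symm this.1, Ne.symm this.2, rfl⟩⟩
        have hdis : Disjoint ({z, w, y} : Finset V) S := by
          rw [disjoint_left] at hzwS ⊢
          intro v hv
          simp only [mem_insert, mem_singleton] at hv hzwS
          rcases hv with rfl | rfl | rfl
          · exact hzwS (Or.inl rfl)
          · exact hzwS (Or.inr rfl)
          · exact hy'.2.1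
        have hcnt := card_filter_subset_disjoint (j := k - 1) hdis (by rw [h3]; omega)
        rw [h3, hS, hD₁.1, Nat.sub_sub, ← hnV, show k - 1 - 3 = k - 4 by omega] at hcnt
        rw [← hcnt]
        refine card_le_card fun D hD => ?_
        rw [mem_filter, mem_powersetCard] at hD
        rw [mem_bipartiteAbove, mem_filter]
        have hsub := hD.2.1
        refine ⟨⟨hYB y hy D hD.1.2 hsub hD.2.2, fun v hv => hsub ?_⟩, hsub (by simp)⟩
        simp only [mem_insert, mem_singleton] at hv ⊢
        tauto)
      (fun D hD => by
        rw [← hBk D (mem_filter.1 hD).1]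
        exact card_le_card fun v hv => (mem_bipartiteBelow _).1 hv |>.2)
    have h0 : 0 < (n - (3 + t)).choose (k - 4) := Nat.choose_pos (by omega)
    refine Nat.le_of_mul_le_mul_right ?_ h0
    calc _ ≤ _ := h
      _ ≤ C₂ * n ^ (k - 4) * (k - 1) := Nat.mul_le_mul_right _ hZ
      _ ≤ C₂ * (c * (n - (3 + t)).choose (k - 4)) * (k - 1) :=
        Nat.mul_le_mul_right _ (Nat.mul_le_mul_left _ (hc n (by omega)))
      _ = _ := by ring
  refine ⟨S, hD₁.1, ?_⟩
  have hcov : ((powersetCard k (univ : Finset V)).filter fun e => ¬ Disjoint e S ∧ e ∉ H) ⊆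
      ((S ×ˢ B).image fun p => insert p.1 p.2) ∪
      (powersetCard k (univ : Finset V)).filter fun e =>
        ∃ x ∈ S, ∃ u ∈ S ∪ Y, x ≠ u ∧ x ∈ e ∧ u ∈ e := by
    intro e he
    obtain ⟨hek, heS, heH⟩ := mem_filter.1 he
    obtain ⟨x, hxe, hxS⟩ := not_disjoint_iff.1 heS
    by_cases hcase : ∃ u ∈ S ∪ Y, x ≠ u ∧ u ∈ e
    · obtain ⟨u, hu, hxu, hue⟩ := hcase
      exact mem_union_right _ (mem_filter.2 ⟨hek, x, hxS, u, hu, hxu, hxe, hue⟩)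
    push Not at hcase
    have hDk : (e.erase x).card = k - 1 := by
      rw [card_erase_of_mem hxe, (mem_powersetCard.1 hek).2]
    refine mem_union_left _ (mem_image.2 ⟨(x, e.erase x), mem_product.2 ⟨hxS, ?_⟩,
      insert_erase hxe⟩)
    by_contra hDB
    have hadj : ∀ y ∈ e.erase x, (kernelGraph q H).Adj x y := by
      intro y hy
      rw [mem_erase] at hy
      have hySY : y ∉ S ∪ Y := fun h => hcase y h hy.1.symm hy.2
      rw [mem_union, not_or] at hySY
      by_contra hxy
      refine hySY.2 (mem_filter.2 ⟨mem_univ _, ?_, hySY.1, x, hxS, hxy⟩)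
      simp only [mem_insert, mem_singleton, not_or]
      constructor
      · rintro rfl
        exact hxy (hSz x hxS)
      · rintro rfl
        exact hxy (hSw x hxS)
    obtain ⟨y, hy, y', hy', hne⟩ := one_lt_card.1 (show 1 < (e.erase x).card by omega)
    have := hcentre _ hDk hDB (by
      rw [disjoint_left]
      intro v hv hvS
      rw [mem_erase] at hv
      exact hcase v (mem_union_left _ hvS) hv.1.symm hv.2) x hxS
      ⟨y, hy, y', hy', hne, hadj y hy, hadj y' hy'⟩
    have := (mem_centres.1 this).2.1
    rw [insert_erase hxe] at this
    exact heH this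
  refine (card_le_card hcov).trans ((card_union_le _ _).trans ?_)
  have hSt : S.card = t := hD₁.1
  have e1 : ((S ×ˢ B).image fun p => insert p.1 p.2).card ≤ t * (C₁ * n ^ (k - 2)) := by
    refine card_image_le.trans ?_
    rw [card_product, hSt]
    exact Nat.mul_le_mul_left _ hB
  have e2 := card_filter_pair_le (A := S) (B := S ∪ Y) (k := k) (by omega)
  have e3 : (S ∪ Y).card ≤ t + (k - 1) * (C₂ * c) :=
    (card_union_le _ _).trans (by rw [hSt]; exact Nat.add_le_add_left hYcard _)
  rw [hSt, ← hnV] at e2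
  calc _ ≤ t * (C₁ * n ^ (k - 2)) + t * (t + (k - 1) * (C₂ * c)) * n ^ (k - 2) :=
        Nat.add_le_add e1 (e2.trans (Nat.mul_le_mul_right _ (Nat.mul_le_mul_left _ e3)))
    _ = _ := by ring

end StructureOfEdges

section SingletonFree

variable {V : Type} [DecidableEq V]

lemma Kernel.card_inter_ne_one {k q : ℕ} {H : Finset (Finset V)} (hH : ∀ e ∈ H, e.card = k)
    (hq : k ≤ q) (hinter : ∀ e ∈ H, ∀ f ∈ H, (e ∩ f).card ≠ 1) {D D' : Finset V}
    (hD : Kernel q H D) (hD' : Kernel q H D') : (D ∩ D').card ≠ 1 := by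
  obtain ⟨e₀, he₀, hs₀, -⟩ := hD' ∅ (by simp) (by simp)
  have h1 : (D' \ D).card ≤ q :=
    (card_le_card (sdiff_subset.trans hs₀)).trans ((hH e₀ he₀).le.trans hq)
  obtain ⟨e, he, hs, hd⟩ := hD (D' \ D) h1 sdiff_disjoint
  obtain ⟨f, hf, hs', hd'⟩ := hD' (e \ D')
    ((card_le_card sdiff_subset).trans ((hH e he).le.trans hq)) sdiff_disjoint
  have : D ∩ D' = e ∩ f := by
    refine Subset.antisymm (inter_subset_inter hs hs') fun v hv => ?_
    rw [mem_inter] at hv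
    have hv' : v ∈ D' := by
      by_contra h
      exact disjoint_left.1 hd' hv.2 (mem_sdiff.2 ⟨hv.1, h⟩)
    refine mem_inter.2 ⟨?_, hv'⟩
    by_contra h
    exact disjoint_left.1 hd hv.1 (mem_sdiff.2 ⟨hv', h⟩)
  rw [this]
  exact hinter e he f hf

/-- The edge `D ∪ P` is attached to the pair `P`: this pair, extended by any vertex of the edge, is
a kernel. -/
def IsAttached (q : ℕ) (H : Finset (Finset V)) (D P : Finset V) : Prop :=
  Disjoint D P ∧ P.card = 2 ∧ D ∪ P ∈ H ∧ ∀ x ∈ D ∪ P, Kernel q H (insert x P)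

lemma IsAttached.eq_of_mem {k q : ℕ} {H : Finset (Finset V)} (hH : ∀ e ∈ H, e.card = k)
    (hq : k ≤ q) (hinter : ∀ e ∈ H, ∀ f ∈ H, (e ∩ f).card ≠ 1) {D P D' P' : Finset V}
    (h : IsAttached q H D P) (h' : IsAttached q H D' P') {x : V} (hx : x ∈ D ∪ P)
    (hx' : x ∈ D' ∪ P') : P = P' := by
  have key : (P ∩ P').card ≠ 1 := by
    obtain ⟨y, hy⟩ := card_pos.1 (show 0 < P.card by rw [h.2.1]; simp)
    obtain ⟨y', hy'⟩ := card_pos.1 (show 0 < P'.card by rw [h'.2.1]; simp)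
    have h1 := h.2.2.2 y (mem_union_right _ hy)
    have h2 := h'.2.2.2 y' (mem_union_right _ hy')
    rw [insert_eq_of_mem hy] at h1
    rw [insert_eq_of_mem hy'] at h2
    exact h1.card_inter_ne_one hH hq hinter h2
  have h1 := (h.2.2.2 x hx).card_inter_ne_one hH hq hinter (h'.2.2.2 x hx')
  rw [← insert_inter_distrib] at h1
  have h2 : (P ∩ P').card ≠ 0 := by
    intro h0
    rw [card_eq_zero] at h0
    simp [h0] at h1
  have h3 : (P ∩ P').card ≤ 2 := (card_le_card inter_subset_left).trans h.2.1.le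
  have h4 : (P ∩ P').card = 2 := by omega
  rw [← eq_of_subset_of_card_le (inter_subset_left (s₁ := P) (s₂ := P')) (by rw [h4, h.2.1]),
    eq_of_subset_of_card_le (inter_subset_right (s₁ := P) (s₂ := P')) (by rw [h4, h'.2.1])]

open scoped Classical in
lemma card_filter_not_isAttached_le (k q : ℕ) (hk : 5 ≤ k) (hq : 2 * k ≤ q) :
    ∃ C : ℕ, ∀ (V : Type) [Fintype V] [DecidableEq V] (H : Finset (Finset V)),
      (∀ e ∈ H, e.card = k) → (∀ e ∈ H, ∀ f ∈ H, (e ∩ f).card ≠ 1) →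
      (H.filter fun e => ¬ ∃ D P, IsAttached q H D P ∧ D ∪ P = e).card ≤
        C * Fintype.card V ^ (k - 3) := by
  obtain ⟨C, hC⟩ := card_le_or_exists_homogeneous (Fin k) q (k - 3) (by simpa using hq)
  refine ⟨C, fun V _ _ H hH hinter => ?_⟩
  set T := H.filter fun e => ¬ ∃ D P, IsAttached q H D P ∧ D ∪ P = e with hT
  have hTk : ∀ e ∈ T, e.card = Fintype.card (Fin k) := fun e he => by
    rw [Fintype.card_fin]
    exact hH e (mem_filter.1 he).1
  refine (card_le_card_enumerations hTk).trans ?_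
  rcases hC V (enumerations (Fin k) T) with h | ⟨F, hFT, ⟨f, hf⟩, J, hu, hJ, hr, hker⟩
  · exact h
  exfalso
  have hinj : Function.Injective f := (mem_enumerations.1 (hFT hf)).1
  have hFT' : ∀ g ∈ F, univ.image g ∈ T := fun g hg => (mem_enumerations.1 (hFT hg)).2
  have hF : ∀ g ∈ F, univ.image g ∈ H := fun g hg => (mem_filter.1 (hFT' g hg)).1
  obtain ⟨a, b, hab, hall⟩ := exists_pair_forall_superset_mem (by simpa using hk) hu hJ
    (fun x hx => by
      have := (hker f hf _ hx).kernel hF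
      refine this.card_inter_ne_one hH (by omega) hinter this ?_
      simp) (by simpa using hr)
  have hP : ({f a, f b} : Finset V) ⊆ univ.image f := by
    simp [insert_subset_iff]
  refine (mem_filter.1 (hFT' f hf)).2 ⟨univ.image f \ {f a, f b}, {f a, f b},
    ⟨sdiff_disjoint, card_pair (hinj.ne hab), ?_, ?_⟩, sdiff_union_of_subset hP⟩
  · rw [sdiff_union_of_subset hP]
    exact hF f hf
  · rw [sdiff_union_of_subset hP]
    intro x hx
    obtain ⟨i, -, rfl⟩ := mem_image.1 hx
    have hmem : ({i, a, b} : Finset (Fin k)) ∈ J := hall _ (by simp) (by simp) fun h => by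
      have h3 : ({i, a, b} : Finset (Fin k)).card ≤ 3 := card_le_three
      rw [h, card_univ, Fintype.card_fin] at h3
      omega
    have := (hker f hf _ hmem).kernel hF
    simpa only [image_insert, image_singleton] using this

open scoped Classical in
/-- Almost all `(k - 2)`-sets are attached to some pair. -/
lemma card_filter_forall_not_isAttached_le (k q : ℕ) (hk : 5 ≤ k) (hq : 2 * k ≤ q) :
    ∃ C : ℕ, ∀ (V : Type) [Fintype V] [DecidableEq V] (H : Finset (Finset V)),
      (∀ e ∈ H, e.card = k) → (∀ e ∈ H, ∀ f ∈ H, (e ∩ f).card ≠ 1) →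
      (Fintype.card V - 2).choose (k - 2) ≤ H.card →
      ((powersetCard (k - 2) (univ : Finset V)).filter fun D => ∀ P, ¬ IsAttached q H D P).card ≤
        C * Fintype.card V ^ (k - 3) := by
  obtain ⟨C, hC⟩ := card_filter_not_isAttached_le k q hk hq
  refine ⟨C + 2, fun V _ _ H hH hinter hcard => ?_⟩
  have h1 := hC V H hH hinter
  have h2 := card_filter_add_card_filter_not (s := H)
    fun e => ∃ D P, IsAttached q H D P ∧ D ∪ P = e
  have h3 := card_filter_add_card_filter_not (s := powersetCard (k - 2) (univ : Finset V))
    fun D => ∃ P, IsAttached q H D P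
  have h4 : (H.filter fun e => ∃ D P, IsAttached q H D P ∧ D ∪ P = e).card ≤
      ((powersetCard (k - 2) (univ : Finset V)).filter fun D => ∃ P, IsAttached q H D P).card := by
    have hex : ∀ e ∈ H.filter fun e => ∃ D P, IsAttached q H D P ∧ D ∪ P = e,
        ∃ D, ∃ P, IsAttached q H D P ∧ D ∪ P = e := fun e he => (mem_filter.1 he).2
    choose! d hd using hex
    refine card_le_card_of_injOn d ?_ ?_
    · intro e he
      obtain ⟨P, hP, hDP⟩ := hd e he
      refine mem_filter.2 ⟨mem_powersetCard.2 ⟨subset_univ _, ?_⟩, P, hP⟩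
      have := hH e (mem_filter.1 he).1
      rw [← hDP, card_union_of_disjoint hP.1, hP.2.1] at this
      omega
    · intro e he e' he' hee
      obtain ⟨P, hP, hDP⟩ := hd e he
      obtain ⟨P', hP', hDP'⟩ := hd e' he'
      have hne : (d e).Nonempty := by
        rw [← card_pos]
        have := hH e (mem_filter.1 he).1
        rw [← hDP, card_union_of_disjoint hP.1, hP.2.1] at this
        omega
      obtain ⟨x, hx⟩ := hne
      have := hP.eq_of_mem hH (by omega) hinter hP' (mem_union_left _ hx)
        (mem_union_left _ (hee ▸ hx))
      rw [← hDP, ← hDP', this, hee]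
  have h5 := choose_succ_le_add (Fintype.card V) 2 (k - 3)
  rw [show k - 3 + 1 = k - 2 by omega] at h5
  rw [card_powersetCard, card_univ] at h3
  simp only [not_exists] at h1 h2 h3 h4
  rw [add_mul]
  simp only [not_exists] at *
  omega

end SingletonFree

section FranklFuredi

open scoped Classical in
lemma exists_pair_card_missing_le (k q : ℕ) (hk : 5 ≤ k) (hq : 2 * k ≤ q) :
    ∃ C n₀ : ℕ, ∀ (V : Type) [Fintype V] [DecidableEq V] (H : Finset (Finset V)),
      n₀ ≤ Fintype.card V → (∀ e ∈ H, e.card = k) → (∀ e ∈ H, ∀ f ∈ H, (e ∩ f).card ≠ 1) →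
      (Fintype.card V - 2).choose (k - 2) ≤ H.card →
      ∃ P : Finset V, P.card = 2 ∧
        ((powersetCard k (univ : Finset V)).filter fun e => P ⊆ e ∧ e ∉ H).card ≤
          C * Fintype.card V ^ (k - 3) := by
  obtain ⟨C₁, h₁⟩ := card_filter_forall_not_isAttached_le k q hk hq
  obtain ⟨C₂, n₂, h₂⟩ := exists_card_filter_subset_le C₁ 1 (k - 2) (by omega)
  obtain ⟨n₃, h₃⟩ := exists_mul_pow_lt_choose C₂ 1 (k - 4)
  obtain ⟨c, hc⟩ := exists_pow_le_mul_choose 2 (k - 4)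
  refine ⟨C₁ + 2 ^ ((k - 2) * (C₂ * c)), n₂ + n₃ + 2 * (2 + (k - 4)) + 1,
    fun V _ _ H hn hH hinter hcard => ?_⟩
  set n := Fintype.card V with hnV
  have hB := h₁ V H hH hinter hcard
  set B := (powersetCard (k - 2) (univ : Finset V)).filter fun D => ∀ P, ¬ IsAttached q H D P
    with hBdef
  have hgood : ∀ D, D.card = k - 2 → D ∉ B → ∃ P, IsAttached q H D P := by
    intro D hDk hDB
    by_contra! h
    exact hDB (mem_filter.2 ⟨mem_powersetCard.2 ⟨subset_univ _, hDk⟩, h⟩)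
  have hBk : ∀ D ∈ B, D.card = k - 2 := fun D hD => (mem_powersetCard.1 (mem_filter.1 hD).1).2
  obtain ⟨Z, hZ1, hZ⟩ := h₂ V (by omega) B hBk (by rwa [show k - 2 - 1 = k - 3 by omega])
  rw [show k - 2 - 1 - 1 = k - 4 by omega, ← hnV] at hZ
  obtain ⟨D₁, hZD₁, P, hD₁⟩ : ∃ D₁, Z ⊆ D₁ ∧ ∃ P, IsAttached q H D₁ P := by
    by_contra! hcon
    have hfull := card_filter_subset_disjoint (A := Z) (B := ∅) (j := k - 2) (by simp)
      (by rw [hZ1]; omega)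
    rw [hZ1, card_empty, Nat.sub_zero, ← hnV] at hfull
    have h := h₃ n (by omega)
    rw [show k - 4 + 1 = k - 2 - 1 by omega, ← hfull] at h
    refine absurd (h.trans_le (card_le_card ?_)) hZ.not_gt
    intro D hD
    rw [mem_filter] at hD
    exact mem_filter.2 ⟨mem_filter.2 ⟨hD.1, hcon D hD.2.1⟩, hD.2.1⟩
  obtain ⟨z, rfl⟩ := card_eq_one.1 hZ1
  rw [singleton_subset_iff] at hZD₁
  set Y := univ.filter fun y => y ≠ z ∧ ∀ D, D.card = k - 2 → z ∈ D → y ∈ D → D ∈ B with hY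
  have hYcard : Y.card ≤ (k - 2) * (C₂ * c) := by
    have h := card_mul_le_card_mul (s := Y) (t := B.filter fun D => {z} ⊆ D)
      (fun y D => y ∈ D) (m := (n - 2).choose (k - 4)) (n := k - 2)
      (fun y hy => by
        obtain ⟨-, hyz, hyB⟩ := mem_filter.1 hy
        have hcnt := card_filter_subset_disjoint (A := {z, y}) (B := ∅) (j := k - 2) (by simp)
          (by rw [card_pair hyz.symm]; omega)
        rw [card_pair hyz.symm, card_empty, Nat.sub_zero, ← hnV,
          show k - 2 - 2 = k - 4 by omega] at hcnt
        rw [← hcnt]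
        refine card_le_card fun D hD => ?_
        simp only [mem_filter, mem_powersetCard, insert_subset_iff, singleton_subset_iff] at hD
        rw [mem_bipartiteAbove, mem_filter, singleton_subset_iff]
        exact ⟨⟨hyB D hD.1.2 hD.2.1.1 hD.2.1.2, hD.2.1.1⟩, hD.2.1.2⟩)
      (fun D hD => by
        rw [← hBk D (mem_filter.1 hD).1]
        exact card_le_card fun v hv => (mem_bipartiteBelow _).1 hv |>.2)
    have h0 : 0 < (n - 2).choose (k - 4) := Nat.choose_pos (by omega)
    refine Nat.le_of_mul_le_mul_right ?_ h0
    calc _ ≤ _ := h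
      _ ≤ C₂ * n ^ (k - 4) * (k - 2) := Nat.mul_le_mul_right _ hZ
      _ ≤ C₂ * (c * (n - 2).choose (k - 4)) * (k - 2) :=
        Nat.mul_le_mul_right _ (Nat.mul_le_mul_left _ (hc n (by omega)))
      _ = _ := by ring
  have hpair : ∀ D, D.card = k - 2 → D ∉ B → z ∈ D → IsAttached q H D P := by
    intro D hDk hDB hzD
    obtain ⟨P', hP'⟩ := hgood D hDk hDB
    rwa [hD₁.eq_of_mem hH (by omega) hinter hP' (mem_union_left _ hZD₁) (mem_union_left _ hzD)]
  refine ⟨P, hD₁.2.1, ?_⟩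
  have hcov : (((powersetCard k (univ : Finset V)).filter fun e => P ⊆ e ∧ e ∉ H).image (· \ P)) ⊆
      B ∪ Y.powerset := by
    intro D hD
    obtain ⟨e, he, rfl⟩ := mem_image.1 hD
    obtain ⟨hek, hPe, heH⟩ := mem_filter.1 he
    have hDk : (e \ P).card = k - 2 := by
      rw [card_sdiff_of_subset hPe, (mem_powersetCard.1 hek).2, hD₁.2.1]
    by_contra hD'
    rw [mem_union, mem_powerset, not_or, not_subset] at hD'
    obtain ⟨hDB, y, hy, hyY⟩ := hD'
    obtain ⟨P', hP'⟩ := hgood _ hDk hDB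
    have : IsAttached q H (e \ P) P := by
      by_cases hyz : y = z
      · exact hpair _ hDk hDB (hyz ▸ hy)
      · simp only [hY, mem_filter, mem_univ, true_and, not_and, not_forall] at hyY
        obtain ⟨D, hDk', hzD, hyD, hDB'⟩ := hyY hyz
        have heq := (hpair D hDk' hDB' hzD).eq_of_mem hH (by omega) hinter hP'
          (mem_union_left _ hyD) (mem_union_left _ hy)
        rwa [← heq] at hP'
    have := this.2.2.1
    rw [sdiff_union_of_subset hPe] at this
    exact heH this
  have hcard' := (card_le_card hcov).trans (card_union_le _ _)
  rw [card_image_of_injOn, card_powerset] at hcard'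
  · rw [add_mul]
    refine hcard'.trans (Nat.add_le_add ?_ ?_)
    · exact hB
    · calc 2 ^ Y.card ≤ 2 ^ ((k - 2) * (C₂ * c)) := Nat.pow_le_pow_right (by simp) hYcard
        _ ≤ _ := Nat.le_mul_of_pos_right _ (Nat.pow_pos (by omega))
  · intro e he e' he' hee
    have h1 := (mem_filter.1 he).2.1
    have h2 := (mem_filter.1 he').2.1
    rw [← sdiff_union_of_subset h1, ← sdiff_union_of_subset h2]
    exact congrArg (· ∪ P) hee

open scoped Classical in
/-- A large `k`-uniform hypergraph in which no two edges meet in exactly one vertex consists of the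
sets containing some pair. -/
theorem exists_pair_of_card_inter_ne_one (k : ℕ) (hk : 5 ≤ k) :
    ∃ n₀ : ℕ, ∀ (V : Type) [Fintype V] [DecidableEq V] (H : Finset (Finset V)),
      n₀ ≤ Fintype.card V → (∀ e ∈ H, e.card = k) → (∀ e ∈ H, ∀ f ∈ H, (e ∩ f).card ≠ 1) →
      (Fintype.card V - 2).choose (k - 2) ≤ H.card →
      ∃ x y : V, x ≠ y ∧ ∀ e, e ∈ H ↔ e.card = k ∧ x ∈ e ∧ y ∈ e := by
  obtain ⟨C, n₁, h₁⟩ := exists_pair_card_missing_le k (2 * k) hk le_rfl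
  obtain ⟨n₂, h₂⟩ := exists_mul_pow_lt_choose C (2 + (k - 1)) (k - 3)
  obtain ⟨c, hc⟩ := exists_pow_le_mul_choose (3 + (k - 1)) (k - 3)
  obtain ⟨n₃, h₃⟩ := exists_mul_pow_lt_choose (2 ^ (k * (C * c))) (3 + (k - 1)) (k - 4)
  refine ⟨n₁ + n₂ + n₃ + 2 * (3 + (k - 1) + (k - 3)), fun V _ _ H hn hH hinter hcard => ?_⟩
  obtain ⟨P, hP2, hP⟩ := h₁ V H (by omega) hH hinter hcard
  set n := Fintype.card V with hnV
  set M := (powersetCard k (univ : Finset V)).filter fun e => P ⊆ e ∧ e ∉ H with hM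
  have hmeet : ∀ f ∈ H, ∀ e, e.card = k → P ⊆ e → (e ∩ f).card = 1 → e ∈ M := by
    intro f hf e hek hPe h1
    exact mem_filter.2 ⟨mem_powersetCard.2 ⟨subset_univ _, hek⟩, hPe,
      fun he => hinter e he f hf h1⟩
  have hone : ∀ f ∈ H, (P ∩ f).card ≠ 1 := by
    intro f hf h1
    have hfP : (f \ P).card = k - 1 := by
      have := card_sdiff_add_card_inter f P
      rw [inter_comm, h1, hH f hf] at this
      omega
    have hcnt := card_filter_subset_disjoint (A := P) (B := f \ P) (j := k) disjoint_sdiff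
      (by rw [hP2]; omega)
    rw [hP2, hfP, Nat.sub_sub, ← hnV] at hcnt
    have h := h₂ n (by omega)
    rw [show k - 3 + 1 = k - 2 by omega, ← hcnt] at h
    refine absurd (h.trans_le (card_le_card ?_)) hP.not_gt
    intro e he
    obtain ⟨hek, hPe, hd⟩ := mem_filter.1 he
    refine hmeet f hf e (mem_powersetCard.1 hek).2 hPe ?_
    rw [← h1]
    congr 1
    ext v
    simp only [mem_inter, and_congr_left_iff]
    refine fun hvf => ⟨fun hve => ?_, fun h => hPe h⟩
    by_contra hvP
    exact disjoint_left.1 hd hve (mem_sdiff.2 ⟨hvf, hvP⟩)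
  set F := H.filter fun e => ¬ P ⊆ e with hF
  have hdisj : ∀ f ∈ F, Disjoint P f := by
    intro f hf
    obtain ⟨hfH, hPf⟩ := mem_filter.1 hf
    have h1 := hone f hfH
    have h2 : (P ∩ f).card ≠ 2 := fun h => hPf (by
      rw [← eq_of_subset_of_card_le (inter_subset_left (s₁ := P) (s₂ := f)) (by rw [h, hP2])]
      exact inter_subset_right)
    have h3 : (P ∩ f).card ≤ 2 := (card_le_card inter_subset_left).trans hP2.le
    rw [disjoint_iff_inter_eq_empty, ← card_eq_zero]
    omega
  have hmiss : ∀ f ∈ F, ∀ v ∈ f, (n - (3 + (k - 1))).choose (k - 3) ≤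
      (M.filter fun e => v ∈ e).card := by
    intro f hf v hv
    have hd := hdisj f hf
    have hvP : v ∉ P := fun h => disjoint_left.1 hd h hv
    have h3 : (insert v P).card = 3 := by rw [card_insert_of_notMem hvP, hP2]
    have hcnt := card_filter_subset_disjoint (A := insert v P) (B := f.erase v) (j := k) (by
      rw [disjoint_insert_left]
      exact ⟨notMem_erase v f, hd.mono_right (erase_subset v f)⟩) (by rw [h3]; omega)
    rw [h3, card_erase_of_mem hv, hH f (mem_filter.1 hf).1, Nat.sub_sub, ← hnV] at hcnt
    rw [← hcnt]
    refine card_le_card fun e he => ?_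
    obtain ⟨hek, hPe, hd'⟩ := mem_filter.1 he
    rw [insert_subset_iff] at hPe
    refine mem_filter.2 ⟨hmeet f (mem_filter.1 hf).1 e (mem_powersetCard.1 hek).2 hPe.2 ?_, hPe.1⟩
    rw [card_eq_one]
    refine ⟨v, ?_⟩
    ext u
    simp only [mem_inter, mem_singleton]
    refine ⟨fun hu => ?_, ?_⟩
    · by_contra huv
      exact disjoint_left.1 hd' hu.1 (mem_erase.2 ⟨huv, hu.2⟩)
    · rintro rfl
      exact ⟨hPe.1, hv⟩
  have hMk : ∀ e ∈ M, e.card = k := fun e he => (mem_powersetCard.1 (mem_filter.1 he).1).2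
  have hcount : (H.filter fun e => P ⊆ e).card + M.card = (n - 2).choose (k - 2) := by
    have h := card_filter_subset_disjoint (A := P) (B := ∅) (j := k) (by simp)
      (by rw [hP2]; omega)
    rw [hP2, card_empty, Nat.sub_zero, ← hnV] at h
    rw [← h, ← card_filter_add_card_filter_not
      (s := (powersetCard k univ).filter fun D => P ⊆ D ∧ Disjoint D ∅) fun e => e ∈ H]
    refine congrArg₂ (· + ·) (congrArg card ?_) (congrArg card ?_)
    · ext e
      simp only [mem_filter, mem_powersetCard, subset_univ, true_and, disjoint_empty_right, and_true]
      exact ⟨fun h => ⟨⟨hH e h.1, h.2⟩, h.1⟩, fun h => ⟨h.2, h.1.2⟩⟩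
    · ext e
      simp only [hM, mem_filter, disjoint_empty_right, and_true]
      tauto
  have hsplit : (H.filter fun e => P ⊆ e).card + F.card = H.card := by
    convert card_filter_add_card_filter_not (s := H) fun e => P ⊆ e
  have hFM : M.card ≤ F.card := by omega
  set R := F.biUnion id with hR
  have hRcard : R.card ≤ k * (C * c) := by
    have h := card_mul_le_card_mul (s := R) (t := M) (fun y e => y ∈ e)
      (m := (n - (3 + (k - 1))).choose (k - 3)) (n := k)
      (fun y hy => by
        obtain ⟨f, hf, hyf⟩ := mem_biUnion.1 hy
        exact hmiss f hf y hyf)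
      (fun e he => by
        rw [← hMk e he]
        exact card_le_card fun v hv => (mem_bipartiteBelow _).1 hv |>.2)
    have h0 : 0 < (n - (3 + (k - 1))).choose (k - 3) := Nat.choose_pos (by omega)
    refine Nat.le_of_mul_le_mul_right ?_ h0
    calc _ ≤ _ := h
      _ ≤ C * n ^ (k - 3) * k := Nat.mul_le_mul_right _ hP
      _ ≤ C * (c * (n - (3 + (k - 1))).choose (k - 3)) * k :=
        Nat.mul_le_mul_right _ (Nat.mul_le_mul_left _ (hc n (by omega)))
      _ = _ := by ring
  have hFR : F.card ≤ 2 ^ (k * (C * c)) := by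
    calc F.card ≤ R.powerset.card := card_le_card fun f hf => by
          rw [mem_powerset]
          exact subset_biUnion_of_mem id hf
      _ ≤ _ := by
        rw [card_powerset]
        exact Nat.pow_le_pow_right (by simp) hRcard
  have hFe : F = ∅ := by
    by_contra hne
    obtain ⟨f, hf⟩ := nonempty_iff_ne_empty.2 hne
    obtain ⟨v, hv⟩ := card_pos.1 (show 0 < f.card by rw [hH f (mem_filter.1 hf).1]; omega)
    have h1 := (hmiss f hf v hv).trans (card_filter_le _ _)
    have h := h₃ n (by omega)
    rw [show k - 4 + 1 = k - 3 by omega] at h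
    have h2 : 2 ^ (k * (C * c)) ≤ 2 ^ (k * (C * c)) * n ^ (k - 4) :=
      Nat.le_mul_of_pos_right _ (Nat.pow_pos (by omega))
    omega
  rw [hFe, card_empty] at hFM
  have hMe : M = ∅ := card_eq_zero.1 (by omega)
  obtain ⟨x, y, hxy, rfl⟩ := card_eq_two.1 hP2
  refine ⟨x, y, hxy, fun e => ⟨fun he => ⟨hH e he, ?_⟩, fun ⟨hek, hx, hy⟩ => ?_⟩⟩
  · by_contra h
    refine notMem_empty e (hFe ▸ mem_filter.2 ⟨he, ?_⟩)
    simpa only [insert_subset_iff, singleton_subset_iff] using h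
  · by_contra h
    refine notMem_empty e (hMe ▸ mem_filter.2 ⟨mem_powersetCard.2 ⟨subset_univ _, hek⟩, ?_, h⟩)
    simp [insert_subset_iff, hx, hy]

end FranklFuredi

section Extremal

lemma exists_pair_of_card_inter_ne_one_of_disjoint (k : ℕ) (hk : 5 ≤ k) :
    ∃ n₀ : ℕ, ∀ (V : Type) [Fintype V] [DecidableEq V] (S : Finset V) (H : Finset (Finset V)),
      n₀ ≤ Fintype.card V - S.card → (∀ e ∈ H, e.card = k) →
      (∀ e ∈ H, ∀ f ∈ H, (e ∩ f).card ≠ 1) → (∀ e ∈ H, Disjoint e S) →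
      (Fintype.card V - S.card - 2).choose (k - 2) ≤ H.card →
      ∃ x y : V, x ∉ S ∧ y ∉ S ∧ x ≠ y ∧
        ∀ e, e ∈ H ↔ e.card = k ∧ Disjoint e S ∧ x ∈ e ∧ y ∈ e := by
  obtain ⟨n₀, h⟩ := exists_pair_of_card_inter_ne_one k hk
  refine ⟨n₀, fun V _ _ S H hn hH hinter hd hcard => ?_⟩
  have hX : Fintype.card {v : V // v ∉ S} = Fintype.card V - S.card := by
    rw [Fintype.card_subtype_compl, Fintype.card_coe]
  have hmap : ∀ e : Finset V, Disjoint e S →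
      (e.subtype (· ∉ S)).map (Function.Embedding.subtype _) = e := by
    intro e he
    rw [subtype_map, filter_true_of_mem]
    exact fun v hv hvS => disjoint_left.1 he hv hvS
  have hmapd : ∀ e : Finset {v : V // v ∉ S},
      Disjoint (e.map (Function.Embedding.subtype _)) S := by
    intro e
    rw [disjoint_left]
    intro v hv
    obtain ⟨u, -, rfl⟩ := mem_map.1 hv
    exact u.2
  have hmap' : ∀ e : Finset {v : V // v ∉ S},
      (e.map (Function.Embedding.subtype _)).subtype (· ∉ S) = e := fun e =>
    map_injective _ (hmap _ (hmapd e))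
  have hmem : ∀ e : Finset {v : V // v ∉ S}, e ∈ H.image (fun e => e.subtype (· ∉ S)) ↔
      e.map (Function.Embedding.subtype _) ∈ H := by
    intro e
    rw [mem_image]
    constructor
    · rintro ⟨f, hf, rfl⟩
      rwa [hmap f (hd f hf)]
    · exact fun he => ⟨_, he, hmap' e⟩
  obtain ⟨x, y, hxy, hall⟩ := h {v : V // v ∉ S} (H.image fun e => e.subtype (· ∉ S))
    (by rwa [hX]) (fun e he => by
      rw [← hH _ ((hmem e).1 he), card_map]) (fun e he f hf => by
      rw [← card_map (Function.Embedding.subtype _), map_inter]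
      exact hinter _ ((hmem e).1 he) _ ((hmem f).1 hf)) (by
      rw [hX, card_image_of_injOn]
      · exact hcard
      · intro e he f hf hef
        rw [← hmap e (hd e he), ← hmap f (hd f hf)]
        exact congrArg (Finset.map _) hef)
  refine ⟨x, y, x.2, y.2, fun h => hxy (Subtype.ext h), fun e => ?_⟩
  have key : ∀ e, Disjoint e S → (e ∈ H ↔ e.card = k ∧ (x : V) ∈ e ∧ (y : V) ∈ e) := by
    intro e he
    have := hall (e.subtype (· ∉ S))
    rw [hmem, hmap e he, ← card_map (Function.Embedding.subtype _), hmap e he, mem_subtype,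
      mem_subtype] at this
    exact this
  constructor
  · intro he
    have := (key e (hd e he)).1 he
    exact ⟨this.1, hd e he, this.2⟩
  · rintro ⟨h1, h2, h3⟩
    exact (key e h2).2 ⟨h1, h3⟩

variable {V : Type} [DecidableEq V]

/-- A path alternating between `U` and `S`. -/
lemma exists_isPath_of_adj {G : SimpleGraph V} {b : V} (t : ℕ) :
    ∀ (S U : Finset V) (a : V), S.card = t + 1 → U.card = t → a ∉ S → b ∉ S → a ≠ b → a ∉ U →
      b ∉ U → Disjoint U S → (∀ s ∈ S, G.Adj a s) → (∀ s ∈ S, G.Adj b s) →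
      (∀ u ∈ U, ∀ s ∈ S, G.Adj u s) →
      ∃ w : G.Walk a b, w.IsPath ∧ w.length = 2 * (t + 1) ∧
        ∀ u ∈ w.support, u = a ∨ u = b ∨ u ∈ S ∨ u ∈ U := by
  induction t with
  | zero =>
    intro S U a hS _ haS hbS hab _ _ _ ha hb _
    obtain ⟨s, rfl⟩ := card_eq_one.1 hS
    rw [mem_singleton] at haS hbS
    refine ⟨.cons (ha s (mem_singleton_self s)) (.cons (hb s (mem_singleton_self s)).symm .nil),
      ?_, by simp, ?_⟩
    · simp [SimpleGraph.Walk.cons_isPath_iff, haS, Ne.symm hbS, hab]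
    · simp only [SimpleGraph.Walk.support_cons, SimpleGraph.Walk.support_nil, List.mem_cons,
        List.not_mem_nil, or_false, mem_singleton]
      tauto
  | succ t ih =>
    intro S U a hS hU haS hbS hab haU hbU hUS ha hb hadj
    obtain ⟨s, hs⟩ := card_pos.1 (show 0 < S.card by omega)
    obtain ⟨u, hu⟩ := card_pos.1 (show 0 < U.card by omega)
    have huS : u ∉ S := disjoint_left.1 hUS hu
    have hub : u ≠ b := fun h => hbU (h ▸ hu)
    obtain ⟨w, hw, hlen, hsup⟩ := ih (S.erase s) (U.erase u) u
      (by rw [card_erase_of_mem hs]; omega) (by rw [card_erase_of_mem hu]; omega)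
      (fun h => huS (mem_of_mem_erase h)) (fun h => hbS (mem_of_mem_erase h)) hub
      (notMem_erase u U) (fun h => hbU (mem_of_mem_erase h))
      (hUS.mono (erase_subset _ _) (erase_subset _ _))
      (fun s hs => hadj u hu s (mem_of_mem_erase hs)) (fun s hs => hb s (mem_of_mem_erase hs))
      (fun u hu s hs => hadj u (mem_of_mem_erase hu) s (mem_of_mem_erase hs))
    have hsw : s ∉ w.support := by
      intro h
      rcases hsup s h with rfl | rfl | h | h
      · exact huS hs
      · exact hbS hs
      · exact notMem_erase s S h
      · exact disjoint_left.1 hUS (mem_of_mem_erase h) hs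
    have haw : a ∉ w.support := by
      intro h
      rcases hsup a h with rfl | h | h | h
      · exact haU hu
      · exact hab h
      · exact haS (mem_of_mem_erase h)
      · exact haU (mem_of_mem_erase h)
    refine ⟨.cons (ha s hs) (.cons (hadj u hu s hs).symm w), ?_, ?_, ?_⟩
    · rw [SimpleGraph.Walk.cons_isPath_iff, SimpleGraph.Walk.cons_isPath_iff,
        SimpleGraph.Walk.support_cons, List.mem_cons, not_or]
      exact ⟨⟨hw, hsw⟩, fun h => haS (h ▸ hs), haw⟩
    · rw [SimpleGraph.Walk.length_cons, SimpleGraph.Walk.length_cons, hlen]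
      ring
    · intro v hv
      rw [SimpleGraph.Walk.support_cons, SimpleGraph.Walk.support_cons, List.mem_cons,
        List.mem_cons] at hv
      rcases hv with rfl | rfl | hv
      · exact Or.inl rfl
      · exact Or.inr (Or.inr (Or.inl hs))
      · rcases hsup v hv with rfl | rfl | h | h
        · exact Or.inr (Or.inr (Or.inr hu))
        · exact Or.inr (Or.inl rfl)
        · exact Or.inr (Or.inr (Or.inl (mem_of_mem_erase h)))
        · exact Or.inr (Or.inr (Or.inr (mem_of_mem_erase h)))

/-- Two edges outside `S` meeting in one vertex complete to a linear cycle if both of them have a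
further vertex adjacent to all of `S` in the kernel graph. -/
lemma exists_linearCyclic_of_card_inter_eq_one [Fintype V] {k t q : ℕ} {H : Finset (Finset V)}
    (ht : 1 ≤ t) (hH : ∀ e ∈ H, e.card = k) (hq : k * (2 * t + 2) ≤ q) {S W : Finset V}
    (hS : S.card = t) (hW : ∀ v, v ∉ S → v ∉ W → ∀ s ∈ S, (kernelGraph q H).Adj v s)
    (hn : W.card + 2 * k + 2 * t ≤ Fintype.card V) {e f : Finset V} (he : e ∈ H) (hf : f ∈ H)
    (heS : Disjoint e S) (hfS : Disjoint f S) (heW : 2 ≤ (e \ W).card) (hfW : 2 ≤ (f \ W).card)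
    (hef : (e ∩ f).card = 1) :
    ∃ A : ZMod (2 * t + 2) → Finset V, IsLinearCyclic A ∧ ∀ i, A i ∈ H := by
  obtain ⟨v, hv⟩ := card_eq_one.1 hef
  obtain ⟨b, hb, hbv⟩ := exists_mem_ne (show 1 < (e \ W).card by omega) v
  obtain ⟨a, ha, hav⟩ := exists_mem_ne (show 1 < (f \ W).card by omega) v
  rw [mem_sdiff] at ha hb
  have hmem : ∀ u, u ∈ e → u ∈ f → u = v := fun u h1 h2 => by
    rw [← mem_singleton, ← hv]
    exact mem_inter.2 ⟨h1, h2⟩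
  have hae : a ∉ e := fun h => hav (hmem a h ha.1)
  have hbf : b ∉ f := fun h => hbv (hmem b hb.1 h)
  have haS : a ∉ S := disjoint_left.1 hfS ha.1
  have hbS : b ∉ S := disjoint_left.1 heS hb.1
  obtain ⟨U, hUs, hU⟩ := exists_subset_card_eq (s := (W ∪ S ∪ e ∪ f)ᶜ) (n := t - 1) (by
    rw [card_compl]
    have h1 := card_union_le (W ∪ S ∪ e) f
    have h2 := card_union_le (W ∪ S) e
    have h3 := card_union_le W S
    rw [hH e he] at h2
    rw [hH f hf] at h1
    omega)
  have hUmem : ∀ u ∈ U, u ∉ W ∧ u ∉ S ∧ u ∉ e ∧ u ∉ f := fun u hu => by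
    have := hUs hu
    simp only [mem_compl, mem_union, not_or] at this
    tauto
  obtain ⟨w, hw, hlen, hsup⟩ := exists_isPath_of_adj (G := kernelGraph q H) (b := b) (t - 1) S U a
    (by omega) hU haS hbS (fun h => hae (h ▸ hb.1)) (fun h => (hUmem a h).2.2.2 ha.1)
    (fun h => (hUmem b h).2.2.1 hb.1) (disjoint_left.2 fun u hu => (hUmem u hu).2.1)
    (hW a haS ha.2) (hW b hbS hb.2) (fun u hu => hW u (hUmem u hu).2.1 (hUmem u hu).1)
  refine exists_linearCyclic_of_isPath ht hH hq w hw (by rw [hlen]; omega) (kernel_of_mem he)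
    (kernel_of_mem hf) hv (fun u hu => ⟨fun hue => ?_, ?_⟩) fun u hu => ⟨fun huf => ?_, ?_⟩
  · rcases hsup u hu with rfl | h | h | h
    · exact absurd hue hae
    · exact h
    · exact absurd h (disjoint_left.1 heS hue)
    · exact absurd hue (hUmem u h).2.2.1
  · rintro rfl
    exact hb.1
  · rcases hsup u hu with h | rfl | h | h
    · exact h
    · exact absurd huf hbf
    · exact absurd h (disjoint_left.1 hfS huf)
    · exact absurd huf (hUmem u h).2.2.2
  · rintro rfl
    exact ha.1

lemma card_filter_sdiff_lt_two_le [Fintype V] (T : Finset (Finset V)) (W : Finset V) :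
    (T.filter fun e => ¬ 2 ≤ (e \ W).card).card ≤ 2 ^ W.card * (Fintype.card V + 1) := by
  calc _ ≤ ((W.powerset ×ˢ (univ : Finset (Option V))).image
        fun p => p.1 ∪ p.2.toFinset).card := by
        refine card_le_card fun e he => ?_
        have h : (e \ W).card ≤ 1 := by
          have := (mem_filter.1 he).2
          omega
        rw [mem_image]
        rcases Nat.le_one_iff_eq_zero_or_eq_one.1 h with h | h
        · refine ⟨(e ∩ W, none), by simp, ?_⟩
          have := sdiff_union_inter e W
          rw [card_eq_zero.1 h] at this
          simpa using this
        · obtain ⟨v, hv⟩ := card_eq_one.1 h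
          refine ⟨(e ∩ W, some v), by simp, ?_⟩
          have := sdiff_union_inter e W
          rw [hv, union_comm] at this
          simpa using this
    _ ≤ _ := card_image_le
    _ = _ := by rw [card_product, card_powerset, card_univ, Fintype.card_option]

end Extremal

section Main

open scoped Classical in
/-- The extremal hypergraphs without linear cycles of length `2 * t + 2`. -/
theorem exists_of_not_exists_linearCyclic (k t : ℕ) (hk : 5 ≤ k) (ht : 1 ≤ t) :
    ∃ n₀ : ℕ, ∀ (V : Type) [Fintype V] [DecidableEq V] (H : Finset (Finset V)),
      n₀ ≤ Fintype.card V → (∀ e ∈ H, e.card = k) →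
      H.card = (Fintype.card V).choose k - (Fintype.card V - t).choose k +
        (Fintype.card V - t - 2).choose (k - 2) →
      (¬ ∃ A : ZMod (2 * t + 2) → Finset V, IsLinearCyclic A ∧ ∀ i, A i ∈ H) →
      ∃ (S : Finset V) (x y : V), S.card = t ∧ x ∉ S ∧ y ∉ S ∧ x ≠ y ∧
        ∀ e, e ∈ H ↔ e.card = k ∧ (¬ Disjoint e S ∨ Disjoint e S ∧ x ∈ e ∧ y ∈ e) := by
  set q := k * (2 * t + 2) + 2 * (k + t) with hq
  obtain ⟨C, n₁, h₁⟩ := exists_card_missing_le k t q hk ht (by omega) (by omega)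
  obtain ⟨n₂, h₂⟩ := exists_pair_of_card_inter_ne_one_of_disjoint k hk
  obtain ⟨c, hc⟩ := exists_pow_le_mul_choose (2 + q) (k - 2)
  obtain ⟨n₃, h₃⟩ := exists_mul_pow_lt_choose (2 ^ (k * (C * c)) * 2) (2 + q) (k - 3)
  refine ⟨n₁ + n₂ + n₃ + k * (C * c) + 2 * k + 2 * t + 2 * (2 + q + (k - 2)),
    fun V _ _ H hn hH hcard hno => ?_⟩
  have hHcard : t * (Fintype.card V - t).choose (k - 1) ≤ H.card := by
    have := choose_add_mul_choose_le (n := Fintype.card V) (t := t) (by omega) (k - 1)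
    rw [show k - 1 + 1 = k by omega] at this
    omega
  obtain ⟨S, hS, hM⟩ := h₁ V H (by omega) hH hno hHcard
  set n := Fintype.card V with hnV
  set M := (powersetCard k (univ : Finset V)).filter fun e => ¬ Disjoint e S ∧ e ∉ H with hMdef
  set B := H.filter fun e => Disjoint e S with hB
  have hMB : B.card = M.card + (n - t - 2).choose (k - 2) := by
    have e1 : B.card + (H.filter fun e => ¬ Disjoint e S).card = H.card :=
      card_filter_add_card_filter_not _
    have e2 : ((powersetCard k (univ : Finset V)).filter fun e => Disjoint e S).card +
        ((powersetCard k (univ : Finset V)).filter fun e => ¬ Disjoint e S).card = n.choose k := by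
      rw [card_filter_add_card_filter_not, card_powersetCard, card_univ]
    have e3 := card_filter_subset_disjoint (A := ∅) (B := S) (j := k) (by simp) (by simp)
    simp only [empty_subset, true_and, card_empty, Nat.sub_zero, hS, ← hnV] at e3
    have e4 : (H.filter fun e => ¬ Disjoint e S).card + M.card =
        ((powersetCard k (univ : Finset V)).filter fun e => ¬ Disjoint e S).card := by
      rw [← card_filter_add_card_filter_not
        (s := (powersetCard k (univ : Finset V)).filter fun e => ¬ Disjoint e S) fun e => e ∈ H]
      refine congrArg₂ (· + ·) (congrArg card ?_) (congrArg card ?_)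
      · ext e
        simp only [mem_filter, mem_powersetCard, subset_univ, true_and]
        exact ⟨fun h => ⟨⟨hH e h.1, h.2⟩, h.1⟩, fun h => ⟨h.2, h.1.2⟩⟩
      · ext e
        simp only [hMdef, mem_filter]
        tauto
    omega
  set W := univ.filter fun v => v ∉ S ∧ ∃ s ∈ S, ¬ (kernelGraph q H).Adj v s with hW
  have hWadj : ∀ v, v ∉ S → v ∉ W → ∀ s ∈ S, (kernelGraph q H).Adj v s := by
    intro v hvS hvW s hs
    by_contra h
    exact hvW (mem_filter.2 ⟨mem_univ v, hvS, s, hs, h⟩)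
  have hmiss : ∀ v ∈ W, (n - (2 + q)).choose (k - 2) ≤ (M.filter fun e => v ∈ e).card := by
    intro v hv
    obtain ⟨-, hvS, s, hs, hadj⟩ := mem_filter.1 hv
    have hvs : v ≠ s := fun h => hvS (h ▸ hs)
    have hker : ¬ Kernel q H {v, s} := fun h => hadj ⟨hvs, h⟩
    unfold Kernel at hker
    push Not at hker
    obtain ⟨Q, hQ, hQd, hQe⟩ := hker
    have hcnt := card_filter_subset_disjoint (j := k) hQd.symm (by rw [card_pair hvs]; omega)
    rw [card_pair hvs, Nat.sub_sub, ← hnV] at hcnt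
    calc _ ≤ (n - (2 + Q.card)).choose (k - 2) := Nat.choose_le_choose _ (by omega)
      _ ≤ _ := by
        rw [← hcnt]
        refine card_le_card fun e he => ?_
        obtain ⟨hek, hse, hd⟩ := mem_filter.1 he
        have hse' := hse
        rw [insert_subset_iff, singleton_subset_iff] at hse'
        exact mem_filter.2 ⟨mem_filter.2 ⟨hek, fun h => disjoint_left.1 h hse'.2 hs,
          fun h => hQe e h hse hd⟩, hse'.1⟩
  have h0 : 0 < (n - (2 + q)).choose (k - 2) := Nat.choose_pos (by omega)
  have hWcard : W.card ≤ k * (C * c) := by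
    have h := card_mul_le_card_mul (s := W) (t := M) (fun y e => y ∈ e) (n := k) hmiss
      (fun e he => by
        rw [← (mem_powersetCard.1 (mem_filter.1 he).1).2]
        exact card_le_card fun v hv => (mem_bipartiteBelow _).1 hv |>.2)
    refine Nat.le_of_mul_le_mul_right ?_ h0
    calc _ ≤ _ := h
      _ ≤ C * n ^ (k - 2) * k := Nat.mul_le_mul_right _ hM
      _ ≤ C * (c * (n - (2 + q)).choose (k - 2)) * k :=
        Nat.mul_le_mul_right _ (Nat.mul_le_mul_left _ (hc n (by omega)))
      _ = _ := by ring
  set B' := B.filter fun e => 2 ≤ (e \ W).card with hB'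
  have hsplit : B'.card + (B.filter fun e => ¬ 2 ≤ (e \ W).card).card = B.card :=
    card_filter_add_card_filter_not _
  have hsmall : W.Nonempty → (B.filter fun e => ¬ 2 ≤ (e \ W).card).card < M.card := by
    rintro ⟨v, hv⟩
    have e1 := (hmiss v hv).trans (card_filter_le _ _)
    have e2 := h₃ n (by omega)
    rw [show k - 3 + 1 = k - 2 by omega] at e2
    refine (card_filter_sdiff_lt_two_le B W).trans_lt ((?_ : _ ≤ _).trans_lt (e2.trans_le e1))
    rw [mul_assoc]
    refine Nat.mul_le_mul (Nat.pow_le_pow_right (by simp) hWcard) ?_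
    have : n ^ 1 ≤ n ^ (k - 3) := Nat.pow_le_pow_right (by omega) (by omega)
    rw [pow_one] at this
    omega
  have hle : (B.filter fun e => ¬ 2 ≤ (e \ W).card).card ≤ M.card := by
    rcases W.eq_empty_or_nonempty with h | h
    · rw [filter_false_of_mem, card_empty]
      · simp
      · intro e he
        rw [h, sdiff_empty, hH e (mem_filter.1 he).1]
        omega
    · exact (hsmall h).le
  obtain ⟨x, y, hx, hy, hxy, hall⟩ := h₂ V S B' (by omega)
    (fun e he => hH e (mem_filter.1 (mem_filter.1 he).1).1)
    (fun e he f hf hef => by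
      obtain ⟨he1, he2⟩ := mem_filter.1 he
      obtain ⟨hf1, hf2⟩ := mem_filter.1 hf
      obtain ⟨he3, he4⟩ := mem_filter.1 he1
      obtain ⟨hf3, hf4⟩ := mem_filter.1 hf1
      exact hno (exists_linearCyclic_of_card_inter_eq_one ht hH (by omega) hS hWadj (by omega)
        he3 hf3 he4 hf4 he2 hf2 hef))
    (fun e he => (mem_filter.1 (mem_filter.1 he).1).2) (by rw [hS, ← hnV]; omega)
  have hB'card : B'.card = (n - t - 2).choose (k - 2) := by
    have h := card_filter_subset_disjoint (A := {x, y}) (B := S) (j := k)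
      (by simp [hx, hy]) (by rw [card_pair hxy]; omega)
    rw [card_pair hxy, hS, Nat.sub_right_comm, ← hnV] at h
    rw [← h]
    congr 1
    ext e
    rw [hall, mem_filter, mem_powersetCard, insert_subset_iff, singleton_subset_iff]
    simp only [subset_univ, true_and]
    tauto
  have hWe : W = ∅ := by
    by_contra h
    have := hsmall (nonempty_iff_ne_empty.2 h)
    omega
  have hBB : B' = B := filter_true_of_mem fun e he => by
    rw [hWe, sdiff_empty, hH e (mem_filter.1 he).1]
    omega
  have hMe : M = ∅ := by
    rw [← card_eq_zero]
    rw [hBB] at hB'card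
    omega
  refine ⟨S, x, y, hS, hx, hy, hxy, fun e => ?_⟩
  by_cases hd : Disjoint e S
  · have := hall e
    rw [hBB, hB, mem_filter] at this
    tauto
  · refine ⟨fun he => ⟨hH e he, Or.inl hd⟩, fun ⟨hek, _⟩ => ?_⟩
    by_contra he
    exact notMem_empty e (hMe ▸ mem_filter.2
      ⟨mem_powersetCard.2 ⟨subset_univ _, hek⟩, hd, he⟩)

lemma IsLinearCyclic.isLinearCycle {k ℓ n : ℕ} {A : ZMod ℓ → Finset (Fin n)} (hk : 2 ≤ k)
    (hA : IsLinearCyclic A) (hAk : ∀ i, (A i).card = k) : IsLinearCycle k ℓ A := by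
  refine ⟨fun i j hij => ?_, hAk, hA.card_inter, hA.disjoint⟩
  by_contra hne
  by_cases h1 : j = i + 1
  · have := hA.card_inter i
    rw [← h1, ← hij, inter_self, hAk] at this
    omega
  by_cases h2 : i = j + 1
  · have := hA.card_inter j
    rw [← h2, hij, inter_self, hAk] at this
    omega
  have := hA.disjoint i j (Ne.symm hne) h1 h2
  rw [← hij, disjoint_self_iff_empty] at this
  have h := hAk i
  rw [this, card_empty] at h
  omega

end Main

end LinearCycle

/-- Theorem 3, even case, extremal structure: for `k ≥ 5` and sufficiently large `n`, any
extremal `k`-uniform hypergraph with no linear cycle of length `2t+2` consists of all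
`k`-sets meeting a fixed `t`-set `S`, plus all `k`-sets disjoint from `S` containing two
fixed elements `x, y ∉ S`. -/
theorem extremal_linear_cycle_even (k t : ℕ) (hk : 5 ≤ k) (ht : 1 ≤ t) :
    ∃ n₀ : ℕ, ∀ n ≥ n₀, ∀ H : Finset (Finset (Fin n)),
      (∀ e ∈ H, e.card = k) →
      H.card = Nat.choose n k - Nat.choose (n - t) k + Nat.choose (n - t - 2) (k - 2) →
      (¬ ∃ A : ZMod (2 * t + 2) → Finset (Fin n),
          IsLinearCycle k (2 * t + 2) A ∧ ∀ i, A i ∈ H) →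
      ∃ (S : Finset (Fin n)) (x y : Fin n), S.card = t ∧ x ∉ S ∧ y ∉ S ∧ x ≠ y ∧
        ∀ e : Finset (Fin n), e ∈ H ↔
          e.card = k ∧ ((e ∩ S).Nonempty ∨ (Disjoint e S ∧ x ∈ e ∧ y ∈ e)) := by
  obtain ⟨n₀, h⟩ := LinearCycle.exists_of_not_exists_linearCyclic k t hk ht
  refine ⟨n₀, fun n hn H hH hcard hno => ?_⟩
  obtain ⟨S, x, y, hS, hx, hy, hxy, hall⟩ := h (Fin n) H (by simpa using hn) hH
    (by simpa using hcard) fun ⟨A, hA, hAH⟩ =>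
      hno ⟨A, hA.isLinearCycle (by omega) fun i => hH _ (hAH i), hAH⟩
  refine ⟨S, x, y, hS, hx, hy, hxy, fun e => ?_⟩
  rw [hall, Finset.not_disjoint_iff_nonempty_inter]
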